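/- arXiv:1404.3900 — 3 statements merged into one kernel-verified Lean document; each statement's English description precedes it below -/
import Mathlib

section
/- Let 𝒫 be an admissible family of positive cones. For any Hermitian map φ ∈ L(H,K), the diamond norm satisfies ‖φ‖_{◇,𝒫} = sup_{ρ ∈ 𝔖(H⊗H)} ‖(φ⊗id_H)(ρ)‖_{1,~𝒫}, where the supremum is over all density operators ρ on H⊗H. -/
noncomputable section

open Matrix Complex Filter
open scoped Kronecker ComplexOrder

/-- The algebra `B(H)` of operators on the Hilbert space with orthonormal basis indexed by `ι`,
modelled as matrices. -/
abbrev Mat (ι : Type) : Type := Matrix ι ι ℂ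

/-- The space of all maps `B(H) → B(K)`. -/
abbrev HMap (ι κ : Type) : Type := Mat ι → Mat κ

section Defs
variable {ι κ μ ν γ γ' : Type}

/-- A Hermitian (i.e. complex-linear and Hermiticity preserving) map `B(H) → B(K)`. -/
def IsHermMap [Fintype ι] [Fintype κ] (φ : HMap ι κ) : Prop :=
  IsLinearMap ℂ φ ∧ ∀ a : Mat ι, φ aᴴ = (φ a)ᴴ

/-- The real vector space `L(H,K)` of Hermitian maps, as a subset of all maps. -/
def LHK (ι κ : Type) [Fintype ι] [Fintype κ] : Set (HMap ι κ) := {φ | IsHermMap φ}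

/-- The functional `s(φ) = ∑_{i,j} ⟨e_i, φ(|e_i⟩⟨e_j|) e_j⟩`. -/
def sC [Fintype ι] [DecidableEq ι] (φ : HMap ι ι) : ℂ :=
  ∑ i, ∑ j, φ (Matrix.single i j 1) i j

/-- The duality pairing `⟨φ,ψ⟩ = s(ψ ∘ φ)` between `L(H,K)` and `L(K,H)`. -/
def pairing [Fintype ι] [DecidableEq ι] [Fintype κ] (φ : HMap ι κ) (ψ : HMap κ ι) : ℝ :=
  (sC (ψ ∘ φ)).re

/-- The map `φ ⊗ id_F`. -/
def tensorId (φ : HMap ι κ) (γ : Type) : Mat (ι × γ) → Mat (κ × γ) :=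
  fun M => Matrix.of fun p q => φ (Matrix.of fun i i' => M (i, p.2) (i', q.2)) p.1 q.1

/-- The map `id ⊗ f` on `B(H ⊗ D)`. -/
def idTensor (ι : Type) (f : HMap γ γ') : Mat (ι × γ) → Mat (ι × γ') :=
  fun M => Matrix.of fun p q => f (Matrix.of fun c c' => M (p.1, c) (q.1, c')) p.2 q.2

/-- The tensor product `φ ⊗ ξ` of two maps. -/
def tensorFun [Fintype ι] [DecidableEq ι] (φ : HMap ι κ) (ξ : HMap γ γ') :
    Mat (ι × γ) → Mat (κ × γ') :=
  fun M => Matrix.of fun p q =>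
    ∑ i, ∑ i', φ (Matrix.single i i' 1) p.1 q.1 *
      ξ (Matrix.of fun c c' => M (i, c) (i', c')) p.2 q.2

/-- The Choi matrix `C(φ) = (φ ⊗ id)(X_H)` of a map `φ : B(H) → B(K)`. -/
def Choi [DecidableEq ι] (φ : HMap ι κ) : Mat (κ × ι) :=
  Matrix.of fun p q => φ (Matrix.single p.2 q.2 1) p.1 q.1

/-- The adjoint of a map with respect to the Hilbert-Schmidt inner products. -/
def adjFun [Fintype ι] [Fintype κ] [DecidableEq ι] (φ : HMap ι κ) : HMap κ ι :=
  fun b => Matrix.of fun i j => (φ (Matrix.single j i 1) * b).trace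

/-- Trace preserving maps. -/
def TP [Fintype ι] [Fintype κ] (φ : HMap ι κ) : Prop := ∀ a, (φ a).trace = a.trace

/-- The cone `Pos(H,K)` of positive Hermitian maps. -/
def PosSet (ι κ : Type) [Fintype ι] [Fintype κ] : Set (HMap ι κ) :=
  {φ | IsHermMap φ ∧ ∀ a, a.PosSemidef → (φ a).PosSemidef}

/-- The cone `CP(H,K)` of completely positive Hermitian maps. -/
def CPSet (ι κ : Type) [Fintype ι] [Fintype κ] : Set (HMap ι κ) :=
  {φ | IsHermMap φ ∧ ∀ (n : ℕ) (M : Mat (ι × Fin n)),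
      M.PosSemidef → (tensorId φ (Fin n) M).PosSemidef}

/-- The cone `EB(H,K)` of entanglement breaking maps `a ↦ ∑_i Tr(F_i a) ρ_i`. -/
def EBSet (ι κ : Type) [Fintype ι] [Fintype κ] : Set (HMap ι κ) :=
  {φ | ∃ (N : ℕ) (F : Fin N → Mat ι) (ρ : Fin N → Mat κ),
      (∀ i, (F i).PosSemidef) ∧ (∀ i, (ρ i).PosSemidef) ∧
      φ = fun a => ∑ i, ((F i * a).trace) • ρ i}

/-- Interior of `Q` relative to the subset `L`. -/
def relInt {X : Type*} [TopologicalSpace X] (L Q : Set X) : Set X :=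
  {x | x ∈ Q ∧ Q ∈ nhdsWithin x L}

/-- A proper cone in the (sub)space `L`: closed, convex, closed under nonnegative scalar
multiples, pointed, and with nonempty interior relative to `L`. -/
def IsProperConeIn {X : Type*} [TopologicalSpace X] [AddCommGroup X] [Module ℝ X]
    (L Q : Set X) : Prop :=
  Q ⊆ L ∧ IsClosed Q ∧ Convex ℝ Q ∧ (∀ c : ℝ, 0 ≤ c → ∀ x ∈ Q, c • x ∈ Q) ∧
    (∀ x, x ∈ Q → -x ∈ Q → x = 0) ∧ (relInt L Q).Nonempty

end Defs

/-- An admissible family of positive cones: a proper cone `Pf(H,K) ⊆ L(H,K)` for every pair of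
(finite-dimensional) Hilbert spaces, with `EB ⊆ Pf ⊆ Pos`, closed under composition and under
composition with completely positive maps. -/
structure AdmissibleFamily : Type 1 where
  P : ∀ (ι κ : Type) [Fintype ι] [DecidableEq ι] [Fintype κ] [DecidableEq κ], Set (HMap ι κ)
  proper : ∀ (ι κ : Type) [Fintype ι] [DecidableEq ι] [Fintype κ] [DecidableEq κ],
    IsProperConeIn (LHK ι κ) (P ι κ)
  eb_le : ∀ (ι κ : Type) [Fintype ι] [DecidableEq ι] [Fintype κ] [DecidableEq κ],
    EBSet ι κ ⊆ P ι κ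
  le_pos : ∀ (ι κ : Type) [Fintype ι] [DecidableEq ι] [Fintype κ] [DecidableEq κ],
    P ι κ ⊆ PosSet ι κ
  comp_mem : ∀ (ι κ μ : Type) [Fintype ι] [DecidableEq ι] [Fintype κ] [DecidableEq κ]
      [Fintype μ] [DecidableEq μ],
    ∀ φ ∈ P ι κ, ∀ ψ ∈ P κ μ, (ψ ∘ φ) ∈ P ι μ
  cp_comp_mem : ∀ (ι κ μ ν : Type) [Fintype ι] [DecidableEq ι] [Fintype κ] [DecidableEq κ]
      [Fintype μ] [DecidableEq μ] [Fintype ν] [DecidableEq ν],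
    ∀ β ∈ CPSet ι κ, ∀ φ ∈ P κ μ, ∀ α ∈ CPSet μ ν, (α ∘ φ ∘ β) ∈ P ι ν

structure FdSubalgebra (ι : Type) [Fintype ι] [DecidableEq ι] : Type where
  car : Set (Mat ι)
  add_mem : ∀ {x y}, x ∈ car → y ∈ car → x + y ∈ car
  smul_mem : ∀ (c : ℂ) {x}, x ∈ car → c • x ∈ car
  one_mem : (1 : Mat ι) ∈ car
  mul_mem : ∀ {x y}, x ∈ car → y ∈ car → x * y ∈ car
  star_mem : ∀ {x}, x ∈ car → xᴴ ∈ car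
  E : Mat ι → Mat ι
  E_linear : IsLinearMap ℂ E
  E_mem : ∀ x, E x ∈ car
  E_fix : ∀ x ∈ car, E x = x
  E_trace : ∀ x y, y ∈ car → (E x * y).trace = (x * y).trace

namespace FdSubalgebra

set_option linter.unusedSectionVars false
variable {ι γ : Type} [Fintype ι] [DecidableEq ι] [Fintype γ] [DecidableEq γ]

lemma zero_mem (A : FdSubalgebra ι) : (0 : Mat ι) ∈ A.car := by
  simpa using A.smul_mem 0 A.one_mem

lemma sum_mem (A : FdSubalgebra ι) {α : Type*} {s : Finset α} {f : α → Mat ι}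
    (h : ∀ a ∈ s, f a ∈ A.car) : (∑ a ∈ s, f a) ∈ A.car :=
  Finset.sum_induction f (· ∈ A.car) (fun _ _ hx hy => A.add_mem hx hy) A.zero_mem h

/-- The full matrix algebra `B(H)`. -/
def full (ι : Type) [Fintype ι] [DecidableEq ι] : FdSubalgebra ι where
  car := Set.univ
  add_mem := fun _ _ => Set.mem_univ _
  smul_mem := by intro _ x _; exact Set.mem_univ _
  one_mem := Set.mem_univ _
  mul_mem := fun _ _ => Set.mem_univ _
  star_mem := fun _ => Set.mem_univ _
  E := id
  E_linear := ⟨fun _ _ => rfl, fun _ _ => rfl⟩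
  E_mem := fun _ => trivial
  E_fix := fun _ _ => rfl
  E_trace := fun _ _ _ => rfl

/-- The diagonal subalgebra `𝔻_n ⊆ B(ℂ^n)`. -/
def diag (n : ℕ) : FdSubalgebra (Fin n) where
  car := {M | ∀ i j, i ≠ j → M i j = 0}
  add_mem := by
    intro x y hx hy i j hij
    simp [hx i j hij, hy i j hij]
  smul_mem := by
    intro c x hx i j hij
    simp [hx i j hij]
  one_mem := by
    intro i j hij
    exact Matrix.one_apply_ne hij
  mul_mem := by
    intro x y hx hy i j hij
    show ∑ k, x i k * y k j = 0
    refine Finset.sum_eq_zero fun k _ => ?_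
    rcases eq_or_ne k i with rfl | hk
    · simp [hy k j hij]
    · simp [hx i k (Ne.symm hk)]
  star_mem := by
    intro x hx i j hij
    simp [Matrix.conjTranspose_apply, hx j i (Ne.symm hij)]
  E := fun M => Matrix.diagonal fun i => M i i
  E_linear := by
    constructor
    · intro x y
      ext i j
      by_cases h : i = j <;> simp [Matrix.diagonal, h]
    · intro c x
      ext i j
      by_cases h : i = j <;> simp [Matrix.diagonal, h]
  E_mem := by
    intro x i j hij
    simp [Matrix.diagonal_apply_ne _ hij]
  E_fix := by
    intro x hx
    ext i j
    by_cases h : i = j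
    · subst h; simp
    · simp [Matrix.diagonal_apply_ne _ h, hx i j h]
  E_trace := by
    intro x y hy
    have key : ∀ z : Mat (Fin n), (z * y).trace = ∑ i, z i i * y i i := by
      intro z
      simp only [Matrix.trace, Matrix.diag, Matrix.mul_apply]
      refine Finset.sum_congr rfl fun i _ => ?_
      refine Finset.sum_eq_single i (fun k _ hk => ?_) (by simp)
      simp [hy k i hk]
    rw [key, key]
    refine Finset.sum_congr rfl fun i _ => ?_
    simp


/-- The `(c,d)` block of a matrix on `H ⊗ D`. -/
def blk (M : Mat (ι × γ)) (c d : γ) : Mat ι := Matrix.of fun i j => M (i, c) (j, d)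

lemma blk_add (M N : Mat (ι × γ)) (c d : γ) : blk (M + N) c d = blk M c d + blk N c d := by
  ext i j; simp [blk]

lemma blk_smul (a : ℂ) (M : Mat (ι × γ)) (c d : γ) : blk (a • M) c d = a • blk M c d := by
  ext i j; simp [blk]

lemma blk_mul (M N : Mat (ι × γ)) (c d : γ) :
    blk (M * N) c d = ∑ e, blk M c e * blk N e d := by
  ext i j
  simp only [blk, Matrix.of_apply, Matrix.mul_apply, Matrix.sum_apply, Fintype.sum_prod_type]
  exact Finset.sum_comm

lemma trace_blk (M : Mat (ι × γ)) : M.trace = ∑ c, (blk M c c).trace := by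
  simp only [Matrix.trace, Matrix.diag, blk, Matrix.of_apply, Fintype.sum_prod_type]
  exact Finset.sum_comm

/-- The tensor product algebra `A ⊗ B(D) ⊆ B(H ⊗ D)`. -/
def tensorFull (A : FdSubalgebra ι) (γ : Type) [Fintype γ] [DecidableEq γ] :
    FdSubalgebra (ι × γ) where
  car := {M | ∀ c d, blk M c d ∈ A.car}
  add_mem := by
    intro x y hx hy c d
    rw [blk_add]; exact A.add_mem (hx c d) (hy c d)
  smul_mem := by
    intro a x hx c d
    rw [blk_smul]; exact A.smul_mem a (hx c d)
  one_mem := by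
    intro c d
    rcases eq_or_ne c d with rfl | hcd
    · have : blk (1 : Mat (ι × γ)) c c = 1 := by
        ext i j
        by_cases h : i = j
        · subst h; simp [blk, Matrix.one_apply]
        · simp [blk, Matrix.one_apply, h]
      rw [this]; exact A.one_mem
    · have : blk (1 : Mat (ι × γ)) c d = 0 := by
        ext i j
        simp [blk, Matrix.one_apply, hcd]
      rw [this]; exact A.zero_mem
  mul_mem := by
    intro x y hx hy c d
    rw [blk_mul]
    exact A.sum_mem fun e _ => A.mul_mem (hx c e) (hy e d)
  star_mem := by
    intro x hx c d
    have : blk xᴴ c d = (blk x d c)ᴴ := by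
      ext i j; simp [blk, Matrix.conjTranspose_apply]
    rw [this]; exact A.star_mem (hx d c)
  E := fun M => Matrix.of fun p q => A.E (blk M p.2 q.2) p.1 q.1
  E_linear := by
    constructor
    · intro x y
      ext p q
      simp [blk_add, (A.E_linear.map_add _ _)]
    · intro a x
      ext p q
      simp [blk_smul, (A.E_linear.map_smul _ _)]
  E_mem := by
    intro x c d
    have : blk (Matrix.of fun p q => A.E (blk x p.2 q.2) p.1 q.1) c d = A.E (blk x c d) := by
      ext i j; simp [blk]
    rw [this]; exact A.E_mem _
  E_fix := by
    intro x hx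
    ext p q
    show A.E (blk x p.2 q.2) p.1 q.1 = x p q
    rw [A.E_fix _ (hx p.2 q.2)]
    rfl
  E_trace := by
    intro x y hy
    have key : ∀ z : Mat (ι × γ), (z * y).trace = ∑ c, ∑ d, (blk z c d * blk y d c).trace := by
      intro z
      rw [trace_blk (z * y)]
      refine Finset.sum_congr rfl fun c _ => ?_
      rw [blk_mul, Matrix.trace_sum]
    rw [key, key]
    refine Finset.sum_congr rfl fun c _ => ?_
    refine Finset.sum_congr rfl fun d _ => ?_
    have hblk : blk (Matrix.of fun p q => A.E (blk x p.2 q.2) p.1 q.1) c d = A.E (blk x c d) := by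
      ext i j; simp [blk]
    rw [hblk, A.E_trace _ _ (hy d c)]

end FdSubalgebra

/-- The positive semidefinite square root of a positive semidefinite matrix (Mathlib's former
`Matrix.PosSemidef.sqrt`). -/
def Matrix.PosSemidef.sqrt {n 𝕜 : Type*} [Fintype n] [RCLike 𝕜] [DecidableEq n]
    {A : Matrix n n 𝕜} (hA : A.PosSemidef) : Matrix n n 𝕜 :=
  hA.1.eigenvectorUnitary.1 * diagonal ((↑) ∘ Real.sqrt ∘ hA.1.eigenvalues) *
    (star hA.1.eigenvectorUnitary : Matrix n n 𝕜)

section Main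
variable {ι κ μ ν γ γ' : Type}
variable [Fintype ι] [DecidableEq ι] [Fintype κ] [DecidableEq κ]

/-- The subspace `L(A,B)` of maps identified with `E_B ∘ φ ∘ E_A`. -/
def LAB (A : FdSubalgebra ι) (B : FdSubalgebra κ) : Set (HMap ι κ) :=
  {φ | (∀ a, φ a ∈ B.car) ∧ ∀ a, φ (A.E a) = φ a}

/-- The density operators (states) of the algebra `A`. -/
def States (A : FdSubalgebra ι) : Set (Mat ι) :=
  {σ | σ ∈ A.car ∧ σ.PosSemidef ∧ σ.trace = 1}

/-- The map `Φ_{I,σ} : a ↦ (Tr a) σ`. -/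
def PhiI (ι : Type) [Fintype ι] (σ : Mat κ) : HMap ι κ := fun a => a.trace • σ

/-- The cone `Pf(A,B) = Pf(H,K) ∩ L(A,B)`. -/
def PL (Pf : AdmissibleFamily) (A : FdSubalgebra ι) (B : FdSubalgebra κ) : Set (HMap ι κ) :=
  Pf.P ι κ ∩ LAB A B

/-- The set `𝒞(A,B)` of `Pf`-channels, i.e. trace preserving maps in `Pf(A,B)`. -/
def ChanP (Pf : AdmissibleFamily) (A : FdSubalgebra ι) (B : FdSubalgebra κ) : Set (HMap ι κ) :=
  {φ | φ ∈ PL Pf A B ∧ TP φ}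

/-- The dual cone `Pf*(A,B) = Pf*(H,K) ∩ L(A,B)`, where `Pf*(H,K) ⊆ L(H,K)` is the dual cone
of `Pf(K,H)` with respect to the pairing `⟨·,·⟩`. -/
def PstarL (Pf : AdmissibleFamily) (A : FdSubalgebra ι) (B : FdSubalgebra κ) :
    Set (HMap ι κ) :=
  {ψ | IsHermMap ψ ∧ ψ ∈ LAB A B ∧ ∀ χ ∈ Pf.P κ ι, 0 ≤ pairing ψ χ}

/-- The diamond norm `‖φ‖_◇ = inf{λ>0 : ∃ α ∈ 𝒞(A,B), λα ± φ ∈ Pf(A,B)}`. -/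
def dnormP (Pf : AdmissibleFamily) (A : FdSubalgebra ι) (B : FdSubalgebra κ)
    (φ : HMap ι κ) : ℝ :=
  sInf {l : ℝ | 0 < l ∧ ∃ α ∈ ChanP Pf A B,
    (l • α - φ) ∈ PL Pf A B ∧ (l • α + φ) ∈ PL Pf A B}

/-- The dual diamond norm `‖φ‖^◇ = inf{λ>0 : ∃ σ ∈ 𝔖(B), λ Φ_{I,σ} ± φ ∈ Pf*(A,B)}`. -/
def udnormP (Pf : AdmissibleFamily) (A : FdSubalgebra ι) (B : FdSubalgebra κ)
    (φ : HMap ι κ) : ℝ :=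
  sInf {l : ℝ | 0 < l ∧ ∃ σ ∈ States B,
    (l • PhiI ι σ - φ) ∈ PstarL Pf A B ∧ (l • PhiI ι σ + φ) ∈ PstarL Pf A B}

/-- `CP(A,B) = CP(H,K) ∩ L(A,B)`. -/
def CPL (A : FdSubalgebra ι) (B : FdSubalgebra κ) : Set (HMap ι κ) :=
  CPSet ι κ ∩ LAB A B

/-- Completely positive trace preserving channels `A → B`. -/
def ChanCP (A : FdSubalgebra ι) (B : FdSubalgebra κ) : Set (HMap ι κ) :=
  {φ | φ ∈ CPL A B ∧ TP φ}

/-- The dual diamond norm with respect to the family `CP` (recall `CP* = CP`). -/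
def udnormCP (A : FdSubalgebra ι) (B : FdSubalgebra κ) (φ : HMap ι κ) : ℝ :=
  sInf {l : ℝ | 0 < l ∧ ∃ σ ∈ States B,
    (l • PhiI ι σ - φ) ∈ CPL A B ∧ (l • PhiI ι σ + φ) ∈ CPL A B}

/-- The qc-map `Φ^qc_A : b ↦ ∑_i Tr(A_i b) |e_i⟩⟨e_i|` given by operators `A_1, …, A_n`. -/
def PhiQC {n : ℕ} (A : Fin n → Mat ι) : HMap ι (Fin n) :=
  fun b => Matrix.diagonal fun i => (A i * b).trace

/-- The cq-map `Φ^cq_A : x ↦ ∑_i ⟨e_i, x e_i⟩ A_i` given by operators `A_1, …, A_n`. -/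
def PhiCQ {n : ℕ} (A : Fin n → Mat ι) : HMap (Fin n) ι :=
  fun x => ∑ i, x i i • A i

/-- The trace norm `‖A‖₁ = Tr √(AᴴA)`. -/
def traceNorm (A : Mat ι) : ℝ :=
  ((Matrix.posSemidef_conjTranspose_mul_self A).sqrt.trace).re

/-- The operator norm of a matrix. -/
def opNorm (A : Mat ι) : ℝ := ‖Matrix.toEuclideanCLM (𝕜 := ℂ) A‖

/-- The cone `C(~Pf(H,K)) ⊆ B_h(K ⊗ H)` of Choi matrices of adjoints of maps in the dual cone
`Pf*(K,H)`. -/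
def tildeCone (Pf : AdmissibleFamily) (ι κ : Type) [Fintype ι] [DecidableEq ι]
    [Fintype κ] [DecidableEq κ] : Set (Mat (κ × ι)) :=
  {X | ∃ ψ : HMap κ ι, IsHermMap ψ ∧ (∀ χ ∈ Pf.P ι κ, 0 ≤ pairing χ ψ) ∧
    X = Choi (adjFun ψ)}

/-- The base norm `‖X‖_{1,~Pf} = sup{Tr XY : -I ≤_{~Pf} Y ≤_{~Pf} I}` on `B_h(K ⊗ H)`. -/
def oneNormTilde (Pf : AdmissibleFamily) (X : Mat (κ × ι)) : ℝ :=
  sSup {r : ℝ | ∃ Y : Mat (κ × ι), (1 - Y) ∈ tildeCone Pf ι κ ∧ (1 + Y) ∈ tildeCone Pf ι κ ∧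
    r = ((X * Y).trace).re}

/-- The order unit norm `‖X‖_C = inf{λ>0 : -λ1 ≤_C X ≤_C λ1}` for a cone `C` of matrices. -/
def ordUnitNorm {α : Type} [Fintype α] [DecidableEq α] (C : Set (Mat α)) (X : Mat α) : ℝ :=
  sInf {l : ℝ | 0 < l ∧ (l • (1 : Mat α) - X) ∈ C ∧ (l • (1 : Mat α) + X) ∈ C}

open Classical in
/-- `(σ + ε I)^{-1/2}`. -/
def invSqrtShift (σ : Mat κ) (ε : ℝ) : Mat κ :=
  if h : (σ + (ε : ℂ) • 1).PosSemidef then h.sqrt⁻¹ else 0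

variable {κ' δ : Type} [Fintype κ'] [DecidableEq κ'] [Fintype δ] [DecidableEq δ]

/-- `Ψ` is `(ε,D)`-post-processing deficient with respect to `Φ` (relative to the family `Pf`):
for every payoff map `Γ ∈ Pf*(D,A)` and every `α ∈ 𝒞(B,D)` there is `α' ∈ 𝒞(B',D)` with
`⟨α∘Φ,Γ⟩ ≤ ⟨α'∘Ψ,Γ⟩ + ε‖Γ‖^◇`. -/
def PostDeficientP (Pf : AdmissibleFamily) (A : FdSubalgebra ι) (B : FdSubalgebra κ)
    (B' : FdSubalgebra κ') (D : FdSubalgebra δ) (Φ : HMap ι κ) (Ψ : HMap ι κ') (ε : ℝ) :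
    Prop :=
  ∀ Γ ∈ PstarL Pf D A, ∀ α ∈ ChanP Pf B D, ∃ α' ∈ ChanP Pf B' D,
    pairing (α ∘ Φ) Γ ≤ pairing (α' ∘ Ψ) Γ + ε * udnormP Pf D A Γ

/-- Post-processing deficiency for the admissible family `CP` (recall `CP* = CP`). -/
def PostDeficientCP (A : FdSubalgebra ι) (B : FdSubalgebra κ)
    (B' : FdSubalgebra κ') (D : FdSubalgebra δ) (Φ : HMap ι κ) (Ψ : HMap ι κ') (ε : ℝ) :
    Prop :=
  ∀ Γ ∈ CPL D A, ∀ α ∈ ChanCP B D, ∃ α' ∈ ChanCP B' D,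
    pairing (α ∘ Φ) Γ ≤ pairing (α' ∘ Ψ) Γ + ε * udnormCP D A Γ

variable {ι' : Type} [Fintype ι'] [DecidableEq ι']

/-- `Ψ` is `(ε,D)`-pre-processing deficient with respect to `Φ` (relative to `Pf`). -/
def PreDeficientP (Pf : AdmissibleFamily) (A : FdSubalgebra ι) (A' : FdSubalgebra ι')
    (B : FdSubalgebra κ) (D : FdSubalgebra δ) (Φ : HMap ι κ) (Ψ : HMap ι' κ) (ε : ℝ) :
    Prop :=
  ∀ Γ ∈ PstarL Pf B D, ∀ β ∈ ChanP Pf D A, ∃ β' ∈ ChanP Pf D A',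
    pairing (Φ ∘ β) Γ ≤ pairing (Ψ ∘ β') Γ + ε * udnormP Pf B D Γ

/-- Pre-processing deficiency for the admissible family `CP`. -/
def PreDeficientCP (A : FdSubalgebra ι) (A' : FdSubalgebra ι') (B : FdSubalgebra κ)
    (D : FdSubalgebra δ) (Φ : HMap ι κ) (Ψ : HMap ι' κ) (ε : ℝ) : Prop :=
  ∀ Γ ∈ CPL B D, ∀ β ∈ ChanCP D A, ∃ β' ∈ ChanCP D A',
    pairing (Φ ∘ β) Γ ≤ pairing (Ψ ∘ β') Γ + ε * udnormCP B D Γ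

/-- `Ψ ⊇_ε Φ`: `sup_{σ ∈ SA} inf_{ρ ∈ SA'} ‖f(σ) - g(ρ)‖₁ ≤ 2ε`. -/
def SupsetCond {α α' β : Type} [Fintype β] [DecidableEq β] (SA : Set (Mat α)) (SA' : Set (Mat α'))
    (f : Mat α → Mat β) (g : Mat α' → Mat β) (ε : ℝ) : Prop :=
  sSup {r : ℝ | ∃ σ ∈ SA, r = sInf {t : ℝ | ∃ ρ ∈ SA', t = traceNorm (f σ - g ρ)}} ≤ 2 * ε

end Main


theorem farkas_aux {E G : Type*} [NormedAddCommGroup E] [NormedSpace ℝ E] [FiniteDimensional ℝ E]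
    [NormedAddCommGroup G] [NormedSpace ℝ G] [FiniteDimensional ℝ G]
    (Q : Set E) (hcl : IsClosed Q) (hzero : (0 : E) ∈ Q)
    (hadd : ∀ x ∈ Q, ∀ y ∈ Q, x + y ∈ Q)
    (hsmul : ∀ c : ℝ, 0 ≤ c → ∀ x ∈ Q, c • x ∈ Q)
    (g : E →ₗ[ℝ] G) (h : G →ₗ[ℝ] ℝ) (hpos : ∀ x ∈ Q, x ≠ 0 → 0 < h (g x))
    (y : G) (hy : ∀ x ∈ Q, g x ≠ y) :
    ∃ f : G →ₗ[ℝ] ℝ, (∀ x ∈ Q, 0 ≤ f (g x)) ∧ f y < 0 := by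
  have hgc : Continuous g := g.continuous_of_finiteDimensional
  have hhc : Continuous h := h.continuous_of_finiteDimensional
  haveI : ProperSpace E := FiniteDimensional.proper ℝ E
  -- lower bound
  have hm : ∃ m : ℝ, 0 < m ∧ ∀ x ∈ Q, m * ‖x‖ ≤ h (g x) := by
    have hK : IsCompact (Q ∩ Metric.sphere (0 : E) 1) :=
      (isCompact_sphere (0 : E) 1).inter_left hcl
    rcases (Q ∩ Metric.sphere (0 : E) 1).eq_empty_or_nonempty with he | hne
    · refine ⟨1, one_pos, fun x hx => ?_⟩
      by_cases hx0 : x = 0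
      · simp [hx0]
      · exfalso
        have hn : ‖x‖ ≠ 0 := norm_ne_zero_iff.2 hx0
        have : (‖x‖⁻¹ • x) ∈ Q ∩ Metric.sphere (0 : E) 1 := by
          refine ⟨hsmul _ (by positivity) x hx, ?_⟩
          simp [norm_smul, hn]
        rw [he] at this
        exact this
    · obtain ⟨x0, hx0, hmin⟩ := hK.exists_isMinOn hne (hhc.comp hgc).continuousOn
      refine ⟨h (g x0), ?_, fun x hx => ?_⟩
      · refine hpos x0 hx0.1 ?_
        rintro rfl
        simpa using hx0.2
      · by_cases hx0' : x = 0
        · simp [hx0']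
        · have hn : ‖x‖ ≠ 0 := norm_ne_zero_iff.2 hx0'
          have hmem : (‖x‖⁻¹ • x) ∈ Q ∩ Metric.sphere (0 : E) 1 := by
            refine ⟨hsmul _ (by positivity) x hx, ?_⟩
            simp [norm_smul, hn]
          have h1 : h (g x0) ≤ h (g (‖x‖⁻¹ • x)) := hmin hmem
          rw [map_smul, map_smul, smul_eq_mul] at h1
          have h2 := mul_le_mul_of_nonneg_right h1 (norm_nonneg x)
          have h3 : ‖x‖⁻¹ * h (g x) * ‖x‖ = h (g x) := by field_simp
          linarith
  obtain ⟨m, hm0, hm⟩ := hm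
  have hTcl : IsClosed (g '' Q) := by
    rw [← closure_subset_iff_isClosed]
    intro z hz
    set R : ℝ := h z + 1 with hR
    have hK : IsCompact (Q ∩ Metric.closedBall (0 : E) (R / m)) :=
      (isCompact_closedBall (0 : E) (R / m)).inter_left hcl
    have hKi : IsClosed (g '' (Q ∩ Metric.closedBall (0 : E) (R / m))) := (hK.image hgc).isClosed
    have hO : IsOpen {w : G | h w < R} := isOpen_lt hhc continuous_const
    have hz1 : z ∈ closure ({w : G | h w < R} ∩ g '' Q) := by
      apply hO.inter_closure
      exact ⟨by simp [hR], hz⟩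
    have hsub : ({w : G | h w < R} ∩ g '' Q) ⊆ g '' (Q ∩ Metric.closedBall (0 : E) (R / m)) := by
      rintro w ⟨hw, x, hx, rfl⟩
      refine ⟨x, ⟨hx, ?_⟩, rfl⟩
      rw [mem_closedBall_zero_iff, le_div_iff₀ hm0]
      have := hm x hx
      have hw' : h (g x) < R := hw
      linarith
    have hz2 := closure_minimal hsub hKi hz1
    obtain ⟨x, hx, rfl⟩ := hz2
    exact ⟨x, hx.1, rfl⟩
  have hTconv : Convex ℝ (g '' Q) := by
    have : Convex ℝ Q := by
      intro x hx y hy a b ha hb _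
      exact hadd _ (hsmul a ha x hx) _ (hsmul b hb y hy)
    exact this.linear_image g
  obtain ⟨f, u, hfu, hfT⟩ := geometric_hahn_banach_point_closed hTconv hTcl
    (x := y) (by rintro ⟨x, hx, hxy⟩; exact hy x hx hxy)
  have hu : u < 0 := by
    have := hfT (g 0) ⟨0, hzero, rfl⟩
    simpa using this
  refine ⟨f.toLinearMap, fun x hx => ?_, lt_trans hfu hu⟩
  by_contra hneg
  have hneg' : f (g x) < 0 := by simpa using hneg
  have hc : 0 ≤ u / f (g x) := div_nonneg_of_nonpos hu.le hneg'.le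
  have := hfT (g ((u / f (g x)) • x)) ⟨_, hsmul _ hc x hx, rfl⟩
  rw [map_smul, map_smul, smul_eq_mul, div_mul_cancel₀ _ hneg'.ne] at this
  exact lt_irrefl _ this


section CStarFacts
open scoped MatrixOrder Matrix.Norms.L2Operator
variable {n : Type} [Fintype n] [DecidableEq n]

lemma psd_factor {A : Mat n} (hA : A.PosSemidef) : ∃ B : Mat n, A = Bᴴ * B :=
  CStarAlgebra.nonneg_iff_eq_star_mul_self.mp hA.nonneg

lemma posdef_sqrt {A : Mat n} (hA : A.PosDef) :
    ∃ s : Mat n, s.IsHermitian ∧ s * s = A ∧ IsUnit s.det := by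
  have h0 : 0 ≤ A := hA.posSemidef.nonneg
  have h1 : CFC.sqrt A * CFC.sqrt A = A := CFC.sqrt_mul_sqrt_self A h0
  refine ⟨CFC.sqrt A, ?_, h1, ?_⟩
  · have : 0 ≤ CFC.sqrt A := CFC.sqrt_nonneg A
    exact (Matrix.nonneg_iff_posSemidef.1 this).1
  · have h2 := congrArg Matrix.det h1
    rw [Matrix.det_mul] at h2
    rw [isUnit_iff_ne_zero]
    intro h3
    rw [h3, zero_mul] at h2
    exact hA.det_pos.ne h2

lemma herm_bound {A : Mat n} (hA : A.IsHermitian) :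
    ∃ c : ℝ, 0 ≤ c ∧ (c • (1 : Mat n) - A).PosSemidef ∧ (c • (1 : Mat n) + A).PosSemidef := by
  have hs : IsSelfAdjoint A := hA
  refine ⟨‖A‖, norm_nonneg _, ?_, ?_⟩
  · have := hs.le_algebraMap_norm_self
    rw [Algebra.algebraMap_eq_smul_one] at this
    exact Matrix.le_iff.1 this
  · have := hs.neg_algebraMap_norm_le_self
    rw [Algebra.algebraMap_eq_smul_one] at this
    have h2 := Matrix.le_iff.1 this
    rwa [sub_neg_eq_add, add_comm] at h2

end CStarFacts

section Aux
variable {ι κ : Type} [Fintype ι] [DecidableEq ι] [Fintype κ] [DecidableEq κ]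

/-- The map with a given Choi matrix. -/
def unC (X : Mat (κ × ι)) : HMap ι κ :=
  fun a => Matrix.of fun k k' => ∑ i, ∑ i', a i i' * X (k, i) (k', i')

/-- The cone of Choi matrices of maps in the family. -/
def QC (Pf : AdmissibleFamily) (ι κ : Type) [Fintype ι] [DecidableEq ι] [Fintype κ]
    [DecidableEq κ] : Set (Mat (κ × ι)) := {X | unC X ∈ Pf.P ι κ}

/-- Partial trace over the first factor. -/
def ptr (M : Mat (κ × ι)) : Mat ι := Matrix.of fun i i' => ∑ k, M (k, i) (k, i')

lemma Choi_unC (X : Mat (κ × ι)) : Choi (unC X) = X := by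
  ext ⟨k, i⟩ ⟨k', i'⟩
  simp only [Choi, unC, Matrix.of_apply]
  rw [Finset.sum_eq_single i, Finset.sum_eq_single i']
  · simp
  · intro b _ hb; simp [Matrix.single_apply, hb.symm]
  · simp
  · intro b _ hb; simp [Matrix.single_apply, hb.symm]
  · simp

lemma lin_expand {φ : HMap ι κ} (h : IsLinearMap ℂ φ) (a : Mat ι) :
    φ a = ∑ i, ∑ j, a i j • φ (Matrix.single i j 1) := by
  conv_lhs => rw [Matrix.matrix_eq_sum_single a]
  have h0 : ∀ x, φ x = (IsLinearMap.mk' φ h) x := fun _ => rfl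
  rw [h0, map_sum]
  refine Finset.sum_congr rfl fun i _ => ?_
  rw [map_sum]
  refine Finset.sum_congr rfl fun j _ => ?_
  rw [← h0, ← h.map_smul, Matrix.smul_single, smul_eq_mul, mul_one]

lemma unC_Choi {φ : HMap ι κ} (h : IsLinearMap ℂ φ) : unC (Choi φ) = φ := by
  funext a
  rw [lin_expand h a]
  ext k k'
  simp [unC, Choi, Matrix.sum_apply]

lemma unC_add (X Y : Mat (κ × ι)) : unC (X + Y) = unC X + unC Y := by
  funext a; ext k k'
  simp [unC, mul_add, Finset.sum_add_distrib]

lemma unC_sub (X Y : Mat (κ × ι)) : unC (X - Y) = unC X - unC Y := by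
  funext a; ext k k'
  simp [unC, mul_sub, Finset.sum_sub_distrib]

lemma unC_smul (c : ℝ) (X : Mat (κ × ι)) : unC (c • X) = c • unC X := by
  funext a; ext k k'
  simp [unC, Finset.mul_sum, mul_left_comm]

lemma Choi_herm {φ : HMap ι κ} (h : IsHermMap φ) : (Choi φ).IsHermitian := by
  ext ⟨k, i⟩ ⟨k', i'⟩
  have h2 := h.2 (Matrix.single i' i 1)
  have h3 := congrFun (congrFun h2 k) k'
  simp only [Matrix.conjTranspose_apply, Matrix.conjTranspose_single, star_one] at h3
  simp [Choi, Matrix.conjTranspose_apply, h3]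

variable (Pf : AdmissibleFamily)

lemma P_zero : (0 : HMap ι κ) ∈ Pf.P ι κ := by
  apply Pf.eb_le
  exact ⟨0, Fin.elim0, Fin.elim0, fun i => i.elim0, fun i => i.elim0, by funext a; simp⟩

lemma P_smul (c : ℝ) (hc : 0 ≤ c) {χ : HMap ι κ} (h : χ ∈ Pf.P ι κ) : c • χ ∈ Pf.P ι κ :=
  (Pf.proper ι κ).2.2.2.1 c hc χ h

lemma P_add {χ ψ : HMap ι κ} (h : χ ∈ Pf.P ι κ) (h' : ψ ∈ Pf.P ι κ) : χ + ψ ∈ Pf.P ι κ := by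
  have := (Pf.proper ι κ).2.2.1 h h' (show (0:ℝ) ≤ 1/2 by norm_num)
    (show (0:ℝ) ≤ 1/2 by norm_num) (by norm_num)
  have h2 := P_smul Pf 2 (by norm_num) this
  rw [smul_add, smul_smul, smul_smul] at h2
  norm_num at h2
  exact h2

lemma P_sum {α : Type*} (s : Finset α) (f : α → HMap ι κ) (h : ∀ a ∈ s, f a ∈ Pf.P ι κ) :
    ∑ a ∈ s, f a ∈ Pf.P ι κ :=
  Finset.sum_induction f (· ∈ Pf.P ι κ) (fun _ _ hx hy => P_add Pf hx hy) (P_zero Pf) h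

lemma QC_zero : (0 : Mat (κ × ι)) ∈ QC Pf ι κ := by
  have : unC (0 : Mat (κ × ι)) = 0 := by funext a; ext k k'; simp [unC]
  show unC _ ∈ Pf.P ι κ
  rw [this]; exact P_zero Pf

lemma QC_add {X Y : Mat (κ × ι)} (h : X ∈ QC Pf ι κ) (h' : Y ∈ QC Pf ι κ) :
    X + Y ∈ QC Pf ι κ := by
  show unC _ ∈ Pf.P ι κ
  rw [unC_add]; exact P_add Pf h h'

lemma QC_smul (c : ℝ) (hc : 0 ≤ c) {X : Mat (κ × ι)} (h : X ∈ QC Pf ι κ) :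
    c • X ∈ QC Pf ι κ := by
  show unC _ ∈ Pf.P ι κ
  rw [unC_smul]; exact P_smul Pf c hc h

lemma QC_closed : IsClosed (QC Pf ι κ) := by
  refine IsClosed.preimage (f := (unC : Mat (κ × ι) → HMap ι κ)) ?_ (Pf.proper ι κ).2.1
  refine continuous_pi fun a => continuous_pi fun k => continuous_pi fun k' => ?_
  simp only [unC, Matrix.of_apply]
  fun_prop

lemma QC_lin {X : Mat (κ × ι)} (h : X ∈ QC Pf ι κ) : IsHermMap (unC X) := (Pf.proper ι κ).1 h

lemma QC_herm {X : Mat (κ × ι)} (h : X ∈ QC Pf ι κ) : X.IsHermitian := by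
  have := Choi_herm (QC_lin Pf h)
  rwa [Choi_unC] at this

lemma Choi_mem {χ : HMap ι κ} (h : χ ∈ Pf.P ι κ) : Choi χ ∈ QC Pf ι κ := by
  show unC _ ∈ Pf.P ι κ
  rwa [unC_Choi ((Pf.proper ι κ).1 h).1]

/-- Conjugation maps are CP. -/
lemma conj_CP {ι κ : Type} [Fintype ι] [DecidableEq ι] [Fintype κ] [DecidableEq κ]
    (K : Matrix κ ι ℂ) : (fun x : Mat ι => K * x * Kᴴ) ∈ CPSet ι κ := by
  refine ⟨⟨⟨fun x y => by rw [Matrix.mul_add, Matrix.add_mul], fun c x => by rw [Matrix.mul_smul, Matrix.smul_mul]⟩, fun a => ?_⟩, ?_⟩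
  · simp [Matrix.conjTranspose_mul, Matrix.mul_assoc]
  · intro n M hM
    have : tensorId (fun x : Mat ι => K * x * Kᴴ) (Fin n) M
        = (K ⊗ₖ (1 : Mat (Fin n))) * M * (K ⊗ₖ (1 : Mat (Fin n)))ᴴ := by
      ext ⟨k, c⟩ ⟨k', c'⟩
      simp only [tensorId, Matrix.of_apply, Matrix.mul_apply, Matrix.kroneckerMap_apply,
        Matrix.conjTranspose_apply, Fintype.sum_prod_type, Matrix.one_apply, mul_ite, ite_mul, mul_one, mul_zero, zero_mul,
        apply_ite star, star_zero, Finset.sum_ite_eq, Finset.mem_univ, if_true]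
    rw [this]
    exact hM.mul_mul_conjTranspose_same _

lemma P_comp_conj {μ : Type} [Fintype μ] [DecidableEq μ] {χ : HMap ι κ} (h : χ ∈ Pf.P ι κ)
    (K : Matrix ι μ ℂ) : (fun x : Mat μ => χ (K * x * Kᴴ)) ∈ Pf.P μ κ := by
  have := Pf.cp_comp_mem μ ι κ κ _ (conj_CP K) χ h _ (conj_CP (1 : Mat κ))
  convert this using 1
  funext x
  simp

/-- Kraus form: applying `χ ⊗ id` to a PSD matrix. -/
lemma tensorId_mem {χ : HMap ι κ} (h : χ ∈ Pf.P ι κ) {ρ : Mat (ι × ι)} (hρ : ρ.PosSemidef) :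
    tensorId χ ι ρ ∈ QC Pf ι κ := by
  obtain ⟨B, rfl⟩ := psd_factor hρ
  have hlin := ((Pf.proper ι κ).1 h).1
  let K : ι × ι → Mat ι := fun m => Matrix.of fun i j => star (B m (i, j))
  have key : tensorId χ ι (Bᴴ * B)
      = Choi (∑ m, (fun x : Mat ι => χ (K m * x * (K m)ᴴ))) := by
    ext ⟨k, j⟩ ⟨k', j'⟩
    simp only [tensorId, Choi, Matrix.of_apply, Finset.sum_apply]
    have hs := map_sum hlin.mk' (fun m => K m * Matrix.single j j' 1 * (K m)ᴴ) Finset.univ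
    simp only [IsLinearMap.mk'_apply] at hs
    have e1 : (∑ m, χ (K m * Matrix.single j j' 1 * (K m)ᴴ)) k k'
        = χ (∑ m, K m * Matrix.single j j' 1 * (K m)ᴴ) k k' := by rw [hs]
    have e2 : (Matrix.of fun i i' => (Bᴴ * B) (i, j) (i', j'))
        = ∑ m, K m * Matrix.single j j' 1 * (K m)ᴴ := by
      ext i i'
      simp only [Matrix.of_apply, Matrix.sum_apply, Matrix.mul_apply, Matrix.conjTranspose_apply]
      refine Finset.sum_congr rfl fun m _ => ?_
      rw [Finset.sum_eq_single j', Finset.sum_eq_single j]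
      · simp [K]
      · intro b _ hb; simp [Matrix.single_apply, hb.symm]
      · simp
      · intro b _ hb; simp [Matrix.single_apply, hb.symm]
      · simp
    rw [e2, ← e1]
    try simp [Matrix.sum_apply]
  rw [key]
  exact Choi_mem Pf (P_sum Pf _ _ fun m _ => P_comp_conj Pf h (K m))

lemma conj_mem {X : Mat (κ × ι)} (h : X ∈ QC Pf ι κ) (t : Mat ι) :
    ((1 : Mat κ) ⊗ₖ t) * X * ((1 : Mat κ) ⊗ₖ t)ᴴ ∈ QC Pf ι κ := by
  have := Choi_mem Pf (P_comp_conj Pf h tᵀ)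
  convert this using 1
  ext ⟨k, j⟩ ⟨k', j'⟩
  simp only [Choi, unC, Matrix.of_apply, Matrix.mul_apply, Matrix.kroneckerMap_apply,
        Matrix.conjTranspose_apply, Fintype.sum_prod_type, Matrix.one_apply, Matrix.transpose_apply]
  simp only [Matrix.single_apply, ite_mul, mul_ite, one_mul, zero_mul, mul_zero, mul_one,
    Finset.sum_ite_eq, Finset.sum_ite_eq', Finset.mem_univ, if_true, star_mul', apply_ite star, star_zero, star_one,
    ite_and, Finset.sum_const_zero, Finset.sum_mul, Finset.mul_sum]
  simp [Finset.sum_ite_irrel, Finset.sum_ite_eq]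
  rw [Finset.sum_comm]
  refine Finset.sum_congr rfl fun i _ => Finset.sum_congr rfl fun i' _ => ?_
  ring

lemma kron_mem {A : Mat κ} {B : Mat ι} (hA : A.PosSemidef) (hB : B.PosSemidef) :
    A ⊗ₖ B ∈ QC Pf ι κ := by
  apply Pf.eb_le
  refine ⟨1, fun _ => Bᵀ, fun _ => A, fun _ => hB.transpose, fun _ => hA, ?_⟩
  funext a
  ext k k'
  simp only [unC, Matrix.of_apply, Matrix.kroneckerMap_apply, Finset.univ_unique,
    Finset.sum_singleton, Matrix.smul_apply, Matrix.trace, Matrix.diag, Matrix.mul_apply,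
    Matrix.transpose_apply, smul_eq_mul, Finset.sum_mul]
  rw [Finset.sum_comm]
  refine Finset.sum_congr rfl fun i _ => Finset.sum_congr rfl fun i' _ => ?_
  ring

end Aux

section Aux2
variable {ι κ : Type} [Fintype ι] [DecidableEq ι] [Fintype κ] [DecidableEq κ]
variable (Pf : AdmissibleFamily)

lemma pairing_eq (χ : HMap ι κ) {ψ : HMap κ ι} (hψ : IsLinearMap ℂ ψ) :
    pairing χ ψ = ((Choi χ * Choi (adjFun ψ)).trace).re := by
  unfold pairing
  congr 1
  have e : ∀ i j : ι, ψ (χ (Matrix.single i j 1)) i j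
      = ∑ k, ∑ k', χ (Matrix.single i j 1) k k' * ψ (Matrix.single k k' 1) i j := by
    intro i j
    rw [lin_expand hψ]
    simp [Matrix.sum_apply]
  have e2 : ∀ (k k' : κ) (i j : ι), Choi (adjFun ψ) (k', j) (k, i) = ψ (Matrix.single k k' 1) i j := by
    intro k k' i j
    simp only [Choi, adjFun, Matrix.of_apply, Matrix.trace_mul_single]
    simp
  simp only [sC, Function.comp, e, Matrix.trace, Matrix.diag, Matrix.mul_apply,
    Fintype.sum_prod_type, e2]
  simp only [Choi, Matrix.of_apply]
  calc _ = ∑ i, ∑ k, ∑ j, ∑ k', χ (Matrix.single i j 1) k k' * ψ (Matrix.single k k' 1) i j :=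
        Finset.sum_congr rfl fun i _ => Finset.sum_comm
    _ = ∑ k, ∑ i, ∑ j, ∑ k', χ (Matrix.single i j 1) k k' * ψ (Matrix.single k k' 1) i j :=
        Finset.sum_comm
    _ = _ := Finset.sum_congr rfl fun i _ => Finset.sum_congr rfl fun i _ => Finset.sum_comm

lemma tilde_iff (X : Mat (κ × ι)) : X ∈ tildeCone Pf ι κ ↔
    X.IsHermitian ∧ ∀ q ∈ QC Pf ι κ, 0 ≤ ((q * X).trace).re := by
  constructor
  · rintro ⟨ψ, hψ, hpos, rfl⟩
    refine ⟨?_, fun q hq => ?_⟩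
    · ext ⟨k, i⟩ ⟨k', i'⟩
      have h3 := congrFun (congrFun (hψ.2 (Matrix.single k k' 1)) i') i
      simp only [Matrix.conjTranspose_apply, Matrix.conjTranspose_single, star_one] at h3
      simp only [Choi, adjFun, Matrix.of_apply, Matrix.trace_mul_single,
        Matrix.conjTranspose_apply]
      simp [h3]
    · have := hpos _ hq
      rwa [pairing_eq _ hψ.1, Choi_unC] at this
  · rintro ⟨hX, hpos⟩
    let ψ : HMap κ ι := fun b => Matrix.of fun i i' => ∑ k, ∑ k', b k k' * X (k', i') (k, i)
    have hlin : IsLinearMap ℂ ψ := by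
      constructor
      · intro x y; ext i i'; simp [ψ, add_mul, Finset.sum_add_distrib]
      · intro c x; ext i i'; simp [ψ, Finset.mul_sum, mul_assoc]
    have hC : Choi (adjFun ψ) = X := by
      ext ⟨k, i⟩ ⟨k', i'⟩
      simp only [Choi, adjFun, Matrix.of_apply, Matrix.trace_mul_single]
      simp only [ψ, Matrix.of_apply]
      rw [Finset.sum_eq_single k', Finset.sum_eq_single k]
      · simp
      · intro b _ hb; simp [Matrix.single_apply, hb.symm]
      · simp
      · intro b _ hb; simp [Matrix.single_apply, hb.symm]
      · simp
    refine ⟨ψ, ⟨hlin, fun b => ?_⟩, fun χ hχ => ?_, hC.symm⟩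
    · ext i i'
      simp only [ψ, Matrix.of_apply, Matrix.conjTranspose_apply, star_sum, star_mul']
      rw [Finset.sum_comm]
      refine Finset.sum_congr rfl fun k _ => Finset.sum_congr rfl fun k' _ => ?_
      rw [← Matrix.conjTranspose_apply X, hX.eq]
    · rw [pairing_eq _ hlin, hC]
      exact hpos _ (Choi_mem Pf hχ)

lemma trace_unC_one (X : Mat (κ × ι)) : (unC X 1).trace = X.trace := by
  simp [unC, Matrix.trace, Matrix.diag, Fintype.sum_prod_type, Matrix.one_apply]

lemma QC_trace_nonneg {X : Mat (κ × ι)} (h : X ∈ QC Pf ι κ) : 0 ≤ X.trace := by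
  rw [← trace_unC_one]
  exact ((Pf.le_pos _ _ h).2 1 Matrix.PosSemidef.one).trace_nonneg

lemma psd_neg_zero {n : Type} [Fintype n] [DecidableEq n] {A : Mat n} (h : A.PosSemidef)
    (h' : (-A).PosSemidef) : A = 0 := by
  have h1 := h.trace_nonneg
  have h2 := h'.trace_nonneg
  rw [Matrix.trace_neg] at h2
  exact h.trace_eq_zero_iff.1 (le_antisymm (neg_nonneg.1 h2) h1)

lemma QC_trace_pos {X : Mat (κ × ι)} (h : X ∈ QC Pf ι κ) (hX : X ≠ 0) : 0 < X.trace.re := by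
  have h0 := QC_trace_nonneg Pf h
  rw [Complex.le_def] at h0
  refine lt_of_le_of_ne h0.1 fun he => hX ?_
  have ht : X.trace = 0 := Complex.ext he.symm h0.2.symm
  have hp := (Pf.le_pos _ _ h)
  have h1 : unC X 1 = 0 :=
    ((hp.2 1 Matrix.PosSemidef.one).trace_eq_zero_iff).1 (by rw [trace_unC_one, ht])
  have hlin := hp.1.1
  have hherm : ∀ a : Mat ι, a.IsHermitian → unC X a = 0 := by
    intro a ha
    obtain ⟨c, -, h2, h3⟩ := herm_bound ha
    have e : ∀ s : ℝ, unC X (s • (1 : Mat ι)) = 0 := by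
      intro s
      have : s • (1 : Mat ι) = (s : ℂ) • 1 := by ext i j; simp
      rw [this, hlin.map_smul, h1, smul_zero]
    have h2' := hp.2 _ h2
    have h3' := hp.2 _ h3
    rw [hlin.map_sub, e, zero_sub] at h2'
    rw [hlin.map_add, e, zero_add] at h3'
    exact psd_neg_zero h3' h2'
  have hall : ∀ a : Mat ι, unC X a = 0 := by
    intro a
    have e1 : unC X (a + aᴴ) = 0 := hherm _ (by
      rw [Matrix.IsHermitian, Matrix.conjTranspose_add, Matrix.conjTranspose_conjTranspose, add_comm])
    have e2 : unC X (Complex.I • (a - aᴴ)) = 0 := hherm _ (by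
      rw [Matrix.IsHermitian, Matrix.conjTranspose_smul, Matrix.conjTranspose_sub,
        Matrix.conjTranspose_conjTranspose]
      simp [smul_sub, sub_eq_add_neg, add_comm])
    rw [hlin.map_add] at e1
    rw [hlin.map_smul, hlin.map_sub] at e2
    have e3 : unC X a - unC X aᴴ = 0 := (smul_eq_zero.1 e2).resolve_left Complex.I_ne_zero
    have e4 : (2 : ℂ) • unC X a = 0 := by
      rw [two_smul]
      calc _ = (unC X a + unC X aᴴ) + (unC X a - unC X aᴴ) := by abel
        _ = 0 := by rw [e1, e3, add_zero]
    exact (smul_eq_zero.1 e4).resolve_left two_ne_zero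
  rw [← Choi_unC X]
  ext p q
  simp [Choi, hall]

/-- `F` is dominated by a multiple of the identity. -/
def OU (F : Mat (κ × ι)) : Prop :=
  ∃ c : ℝ, (c • (1 : Mat (κ × ι)) - F) ∈ QC Pf ι κ ∧ (c • (1 : Mat (κ × ι)) + F) ∈ QC Pf ι κ

variable {Pf}

lemma OU.add {F G : Mat (κ × ι)} (hF : OU Pf F) (hG : OU Pf G) : OU Pf (F + G) := by
  obtain ⟨c, h1, h2⟩ := hF
  obtain ⟨d, h3, h4⟩ := hG
  refine ⟨c + d, ?_, ?_⟩
  · convert QC_add Pf h1 h3 using 1; rw [add_smul]; abel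
  · convert QC_add Pf h2 h4 using 1; rw [add_smul]; abel

lemma OU.neg {F : Mat (κ × ι)} (hF : OU Pf F) : OU Pf (-F) := by
  obtain ⟨c, h1, h2⟩ := hF
  exact ⟨c, by simpa using h2, by simpa [← sub_eq_add_neg] using h1⟩

lemma OU.sub {F G : Mat (κ × ι)} (hF : OU Pf F) (hG : OU Pf G) : OU Pf (F - G) := by
  rw [sub_eq_add_neg]; exact hF.add hG.neg

lemma OU.smul_nonneg {F : Mat (κ × ι)} (hF : OU Pf F) (t : ℝ) (ht : 0 ≤ t) : OU Pf (t • F) := by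
  obtain ⟨c, h1, h2⟩ := hF
  refine ⟨t * c, ?_, ?_⟩
  · convert QC_smul Pf t ht h1 using 1; rw [smul_sub, smul_smul]
  · convert QC_smul Pf t ht h2 using 1; rw [smul_add, smul_smul]

variable (Pf)

lemma OU_zero : OU Pf (0 : Mat (κ × ι)) :=
  ⟨0, by simpa using QC_zero Pf, by simpa using QC_zero Pf⟩

lemma OU_sum {α : Type*} (s : Finset α) (f : α → Mat (κ × ι)) (h : ∀ a ∈ s, OU Pf (f a)) :
    OU Pf (∑ a ∈ s, f a) :=
  Finset.sum_induction f (OU Pf) (fun _ _ hx hy => hx.add hy) (OU_zero Pf) h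

lemma smul_one_psd {n : Type} [Fintype n] [DecidableEq n] {c : ℝ} (hc : 0 ≤ c) :
    (c • (1 : Mat n)).PosSemidef := Matrix.PosSemidef.one.smul hc

lemma OU_psd {A : Mat κ} {B : Mat ι} (hA : A.PosSemidef) (hB : B.PosSemidef) :
    OU Pf (A ⊗ₖ B) := by
  obtain ⟨s, hs0, hs, -⟩ := herm_bound hA.1
  obtain ⟨t, ht0, ht, -⟩ := herm_bound hB.1
  have hst : (s * t) • (1 : Mat (κ × ι)) = (s • (1 : Mat κ)) ⊗ₖ (t • (1 : Mat ι)) := by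
    rw [Matrix.smul_kronecker, Matrix.kronecker_smul, Matrix.one_kronecker_one, smul_smul]
  refine ⟨s * t, ?_, ?_⟩
  · convert QC_add Pf (kron_mem Pf hs (smul_one_psd (n := ι) ht0)) (kron_mem Pf hA ht) using 1
    rw [hst]
    ext ⟨k, i⟩ ⟨k', i'⟩
    simp only [Matrix.add_apply, Matrix.sub_apply, Matrix.kroneckerMap_apply]
    ring
  · rw [hst]
    exact QC_add Pf (kron_mem Pf (smul_one_psd hs0) (smul_one_psd ht0)) (kron_mem Pf hA hB)

lemma OU_kron {A : Mat κ} {B : Mat ι} (hA : A.IsHermitian) (hB : B.IsHermitian) :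
    OU Pf (A ⊗ₖ B) := by
  obtain ⟨s, hs0, -, hs⟩ := herm_bound hA
  obtain ⟨t, ht0, -, ht⟩ := herm_bound hB
  have e : A ⊗ₖ B = (s • 1 + A) ⊗ₖ (t • 1 + B) - (s • 1 + A) ⊗ₖ (t • (1 : Mat ι))
      - (s • (1 : Mat κ)) ⊗ₖ (t • 1 + B) + (s • (1 : Mat κ)) ⊗ₖ (t • (1 : Mat ι)) := by
    simp only [Matrix.add_kronecker, Matrix.kronecker_add]
    abel
  rw [e]
  exact (((OU_psd Pf hs ht).sub (OU_psd Pf hs (smul_one_psd ht0))).sub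
    (OU_psd Pf (smul_one_psd hs0) ht)).add (OU_psd Pf (smul_one_psd hs0) (smul_one_psd ht0))

lemma OU_all {F : Mat (κ × ι)} (hF : F.IsHermitian) : OU Pf F := by
  -- the Hermitian part of a product
  have h1 : ∀ (A : Mat κ) (B : Mat ι), OU Pf (A ⊗ₖ B + (A ⊗ₖ B)ᴴ) := by
    intro A B
    have hA1 : (A + Aᴴ).IsHermitian := by
      rw [Matrix.IsHermitian, Matrix.conjTranspose_add, Matrix.conjTranspose_conjTranspose, add_comm]
    have hB1 : (B + Bᴴ).IsHermitian := by
      rw [Matrix.IsHermitian, Matrix.conjTranspose_add, Matrix.conjTranspose_conjTranspose, add_comm]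
    have hA2 : (Complex.I • (A - Aᴴ)).IsHermitian := by
      rw [Matrix.IsHermitian, Matrix.conjTranspose_smul, Matrix.conjTranspose_sub,
        Matrix.conjTranspose_conjTranspose]
      simp [smul_sub, sub_eq_add_neg, add_comm]
    have hB2 : (Complex.I • (B - Bᴴ)).IsHermitian := by
      rw [Matrix.IsHermitian, Matrix.conjTranspose_smul, Matrix.conjTranspose_sub,
        Matrix.conjTranspose_conjTranspose]
      simp [smul_sub, sub_eq_add_neg, add_comm]
    have h := ((OU_kron Pf hA1 hB1).sub (OU_kron Pf hA2 hB2)).smul_nonneg (1/2) (by norm_num)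
    convert h using 1
    ext ⟨k, i⟩ ⟨k', i'⟩
    simp only [Matrix.add_apply, Matrix.sub_apply, Matrix.smul_apply, Matrix.kroneckerMap_apply,
      Matrix.conjTranspose_apply, smul_eq_mul, Complex.real_smul, star_mul']
    push_cast
    linear_combination (1/2 : ℂ) * ((A k k' - star (A k' k)) * (B i i' - star (B i' i))) * Complex.I_sq
  have h2 : F + Fᴴ = ∑ p, ∑ q, ((F p q • Matrix.single p.1 q.1 (1:ℂ)) ⊗ₖ Matrix.single p.2 q.2 (1:ℂ)
      + ((F p q • Matrix.single p.1 q.1 (1:ℂ)) ⊗ₖ Matrix.single p.2 q.2 (1:ℂ))ᴴ) := by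
    have h3 : F = ∑ p, ∑ q, ((F p q • Matrix.single p.1 q.1 (1:ℂ)) ⊗ₖ Matrix.single p.2 q.2 (1:ℂ)) := by
      conv_lhs => rw [Matrix.matrix_eq_sum_single F]
      refine Finset.sum_congr rfl fun p _ => Finset.sum_congr rfl fun q _ => ?_
      rw [Matrix.smul_kronecker, Matrix.single_kronecker_single]
      simp
    simp only [Finset.sum_add_distrib]
    rw [← h3]
    congr 1
    conv_lhs => rw [h3]
    simp only [Matrix.conjTranspose_sum]
  have h4 : OU Pf (F + Fᴴ) := by
    rw [h2]
    exact OU_sum Pf _ _ fun p _ => OU_sum Pf _ _ fun q _ => h1 _ _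
  rw [hF.eq] at h4
  have h5 := h4.smul_nonneg (1/2) (by norm_num)
  convert h5 using 1
  rw [← two_smul ℝ F, smul_smul]
  norm_num

end Aux2

section Aux3
variable {ι κ : Type} [Fintype ι] [DecidableEq ι] [Fintype κ] [DecidableEq κ]
variable (Pf : AdmissibleFamily)

/-- The feasible set of the diamond norm. -/
def dset (φ : HMap ι κ) : Set ℝ :=
  {l : ℝ | 0 < l ∧ ∃ α ∈ ChanP Pf (FdSubalgebra.full ι) (FdSubalgebra.full κ),
    (l • α - φ) ∈ PL Pf (FdSubalgebra.full ι) (FdSubalgebra.full κ) ∧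
    (l • α + φ) ∈ PL Pf (FdSubalgebra.full ι) (FdSubalgebra.full κ)}

lemma mem_PL_full (χ : HMap ι κ) :
    χ ∈ PL Pf (FdSubalgebra.full ι) (FdSubalgebra.full κ) ↔ χ ∈ Pf.P ι κ :=
  ⟨fun h => h.1, fun h => ⟨h, fun _ => Set.mem_univ _, fun _ => rfl⟩⟩

lemma trace_tensorId {α : HMap ι κ} (hα : TP α) (ρ : Mat (ι × ι)) :
    (tensorId α ι ρ).trace = ρ.trace := by
  rw [FdSubalgebra.trace_blk, FdSubalgebra.trace_blk]
  refine Finset.sum_congr rfl fun c _ => ?_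
  exact hα (FdSubalgebra.blk ρ c c)

lemma weak_dual {φ : HMap ι κ} {l : ℝ} (hl : l ∈ dset Pf φ) {ρ : Mat (ι × ι)}
    (hρ : ρ.PosSemidef) (htr : ρ.trace = 1) {Y : Mat (κ × ι)}
    (h1 : (1 - Y) ∈ tildeCone Pf ι κ) (h2 : (1 + Y) ∈ tildeCone Pf ι κ) :
    ((tensorId φ ι ρ * Y).trace).re ≤ l := by
  obtain ⟨-, α, hα, hm, hp⟩ := hl
  rw [mem_PL_full] at hm hp
  have hM := tensorId_mem Pf hm hρ
  have hP := tensorId_mem Pf hp hρ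
  have eM : tensorId (l • α - φ) ι ρ = l • tensorId α ι ρ - tensorId φ ι ρ := by
    ext p q; simp [tensorId]
  have eP : tensorId (l • α + φ) ι ρ = l • tensorId α ι ρ + tensorId φ ι ρ := by
    ext p q; simp [tensorId]
  have a1 := ((tilde_iff Pf _).1 h2).2 _ hM
  have a2 := ((tilde_iff Pf _).1 h1).2 _ hP
  rw [eM] at a1
  rw [eP] at a2
  have e : ((l • tensorId α ι ρ - tensorId φ ι ρ) * (1 + Y)).trace
      + ((l • tensorId α ι ρ + tensorId φ ι ρ) * (1 - Y)).trace
      = 2 * (l : ℂ) - 2 * (tensorId φ ι ρ * Y).trace := by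
    have ht : (tensorId α ι ρ).trace = 1 := by rw [trace_tensorId hα.2, htr]
    simp only [Matrix.mul_add, Matrix.mul_sub, Matrix.add_mul, Matrix.sub_mul, Matrix.mul_one,
      Matrix.trace_add, Matrix.trace_sub, Matrix.trace_smul, Matrix.smul_mul, ht,
      Complex.real_smul]
    ring
  have e' := congrArg Complex.re e
  simp at e'
  linarith

lemma one_mem_QC : (1 : Mat (κ × ι)) ∈ QC Pf ι κ := by
  rw [← Matrix.one_kronecker_one]
  exact kron_mem Pf Matrix.PosSemidef.one Matrix.PosSemidef.one

lemma one_mem_tilde : (1 : Mat (κ × ι)) ∈ tildeCone Pf ι κ := by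
  rw [tilde_iff]
  refine ⟨Matrix.isHermitian_one, fun q hq => ?_⟩
  rw [Matrix.mul_one]
  exact (Complex.le_def.1 (QC_trace_nonneg Pf hq)).1

lemma TP_unC {M : Mat (κ × ι)} (h : ptr M = 1) : TP (unC M) := by
  intro a
  have h' : ∀ i i', ∑ k, M (k, i) (k, i') = if i = i' then 1 else 0 := by
    intro i i'
    have := congrFun (congrFun h i) i'
    simpa [ptr, Matrix.one_apply] using this
  simp only [unC, Matrix.trace, Matrix.diag, Matrix.of_apply]
  rw [Finset.sum_comm]
  refine Finset.sum_congr rfl fun i _ => ?_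
  rw [Finset.sum_comm]
  simp only [← Finset.mul_sum, h']
  simp

lemma mem_dset_of {φ : HMap ι κ} (hφ : IsHermMap φ) {l : ℝ} (hl : 0 < l)
    {q1 q2 : Mat (κ × ι)} (h1 : q1 ∈ QC Pf ι κ) (h2 : q2 ∈ QC Pf ι κ)
    (ht : ptr (q1 + q2) = (2 * l) • 1) (hF : q2 - q1 = (2 : ℝ) • Choi φ) : l ∈ dset Pf φ := by
  have hφC := unC_Choi hφ.1
  refine ⟨hl, unC ((2 * l)⁻¹ • (q1 + q2)), ⟨(mem_PL_full Pf _).2 ?_, TP_unC ?_⟩, ?_, ?_⟩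
  · exact QC_smul Pf _ (by positivity) (QC_add Pf h1 h2)
  · have : ptr ((2 * l)⁻¹ • (q1 + q2)) = (2 * l)⁻¹ • ptr (q1 + q2) := by
      ext i j; simp only [ptr, Matrix.of_apply, Matrix.smul_apply, Finset.smul_sum]
    rw [this, ht, smul_smul, inv_mul_cancel₀ (by positivity), one_smul]
  · rw [mem_PL_full]
    have : l • unC ((2 * l)⁻¹ • (q1 + q2)) - φ = unC q1 := by
      rw [← unC_smul]
      conv_lhs => rw [← hφC]
      rw [← unC_sub]
      congr 1
      have e : Choi φ = (1/2 : ℝ) • (q2 - q1) := by rw [hF, smul_smul]; norm_num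
      rw [e, smul_smul]
      have : l * (2 * l)⁻¹ = 1/2 := by field_simp
      rw [this, ← smul_sub]
      have : q1 + q2 - (q2 - q1) = (2:ℝ) • q1 := by rw [two_smul]; abel
      rw [this, smul_smul]; norm_num
    rw [this]; exact h1
  · rw [mem_PL_full]
    have : l • unC ((2 * l)⁻¹ • (q1 + q2)) + φ = unC q2 := by
      rw [← unC_smul]
      conv_lhs => rw [← hφC]
      rw [← unC_add]
      congr 1
      have e : Choi φ = (1/2 : ℝ) • (q2 - q1) := by rw [hF, smul_smul]; norm_num
      rw [e, smul_smul]
      have : l * (2 * l)⁻¹ = 1/2 := by field_simp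
      rw [this, ← smul_add]
      have : q1 + q2 + (q2 - q1) = (2:ℝ) • q2 := by rw [two_smul]; abel
      rw [this, smul_smul]; norm_num
    rw [this]; exact h2

lemma dset_nonempty [Nonempty κ] {φ : HMap ι κ} (hφ : IsHermMap φ) : (dset Pf φ).Nonempty := by
  obtain ⟨c, h1, h2⟩ := OU_all Pf (Choi_herm hφ)
  set d : ℝ := |c| + 1 with hd
  have hdc : 0 ≤ d - c := by have := le_abs_self c; linarith
  have hd0 : 0 < d := by positivity
  have hk : (0:ℝ) < Fintype.card κ := by exact_mod_cast Fintype.card_pos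
  have h1' := QC_add Pf h1 (QC_smul Pf _ hdc (one_mem_QC Pf))
  have h2' := QC_add Pf h2 (QC_smul Pf _ hdc (one_mem_QC Pf))
  refine ⟨d * Fintype.card κ, mem_dset_of Pf hφ (by positivity) h1' h2' ?_ ?_⟩
  · have : c • (1 : Mat (κ × ι)) - Choi φ + (d - c) • 1 + (c • 1 + Choi φ + (d - c) • 1)
        = (2 * d) • 1 := by
      rw [sub_smul, mul_smul, two_smul]; abel
    rw [this]
    ext i j
    by_cases hij : i = j
    · subst hij
      simp [ptr, Matrix.one_apply]
      ring
    · simp [ptr, Matrix.one_apply, hij]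
  · rw [two_smul]; abel

lemma trace_ptr (M : Mat (κ × ι)) (σ : Mat ι) :
    (ptr M * σ).trace = (M * ((1 : Mat κ) ⊗ₖ σ)).trace := by
  simp only [ptr, Matrix.trace, Matrix.diag, Matrix.mul_apply, Matrix.of_apply,
    Fintype.sum_prod_type, Matrix.kroneckerMap_apply, Matrix.one_apply, Finset.sum_mul]
  simp only [ite_mul, one_mul, zero_mul, mul_ite, mul_zero]
  rw [Finset.sum_comm' (t' := Finset.univ) (s' := fun _ => Finset.univ) (by simp)]
  calc _ = ∑ k, ∑ i, ∑ j, M (k, i) (k, j) * σ j i := by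
        rw [Finset.sum_comm]
        simp only [Finset.sum_comm (s := (Finset.univ : Finset ι)) (t := (Finset.univ : Finset κ))]
    _ = _ := by
        refine Finset.sum_congr rfl fun k _ => Finset.sum_congr rfl fun i _ => ?_
        rw [Finset.sum_comm]
        simp

lemma repr_functional {n : Type} [Fintype n] [DecidableEq n] (g : Mat n →ₗ[ℝ] ℝ) :
    ∃ Y : Mat n, Y.IsHermitian ∧ ∀ X : Mat n, X.IsHermitian → g X = ((X * Y).trace).re := by
  let Y0 : Mat n := Matrix.of fun q p =>
    (⟨g (Matrix.single p q 1), - g (Matrix.single p q Complex.I)⟩ : ℂ)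
  have h0 : ∀ X : Mat n, g X = ((X * Y0).trace).re := by
    intro X
    conv_lhs => rw [Matrix.matrix_eq_sum_single X]
    simp only [map_sum, Matrix.trace, Matrix.diag, Matrix.mul_apply, Complex.re_sum]
    refine Finset.sum_congr rfl fun i _ => Finset.sum_congr rfl fun j _ => ?_
    have e : Matrix.single i j (X i j)
        = (X i j).re • Matrix.single i j (1:ℂ) + (X i j).im • Matrix.single i j Complex.I := by
      rw [Matrix.smul_single, Matrix.smul_single, ← Matrix.single_add]
      congr 1
      simp [Complex.re_add_im]
    rw [e, map_add, map_smul, map_smul]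
    simp [Y0, Complex.mul_re]
  refine ⟨(1/2 : ℝ) • (Y0 + Y0ᴴ), ?_, fun X hX => ?_⟩
  · rw [Matrix.IsHermitian, Matrix.conjTranspose_smul, Matrix.conjTranspose_add,
      Matrix.conjTranspose_conjTranspose, add_comm]
    simp
  · have e : (X * Y0ᴴ).trace = star (X * Y0).trace := by
      rw [← Matrix.trace_conjTranspose, Matrix.conjTranspose_mul, hX.eq, Matrix.trace_mul_comm]
    rw [h0 X, Matrix.mul_smul, Matrix.mul_add, Matrix.trace_smul, Matrix.trace_add, e]
    simp
    ring

lemma core [Nonempty ι] {φ : HMap ι κ} (hφ : IsHermMap φ) {S : ℝ}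
    (hS : ∀ ρ : Mat (ι × ι), ρ.PosSemidef → ρ.trace = 1 → ∀ Y : Mat (κ × ι),
      (1 - Y) ∈ tildeCone Pf ι κ → (1 + Y) ∈ tildeCone Pf ι κ →
      ((tensorId φ ι ρ * Y).trace).re ≤ S)
    {σ : Mat ι} (hσ : σ.PosDef) {Y : Mat (κ × ι)} (hY : Y.IsHermitian)
    (h1 : ∀ q ∈ QC Pf ι κ, 0 ≤ ((q * ((1 : Mat κ) ⊗ₖ σ - Y)).trace).re)
    (h2 : ∀ q ∈ QC Pf ι κ, 0 ≤ ((q * ((1 : Mat κ) ⊗ₖ σ + Y)).trace).re) :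
    - ((Choi φ * Y).trace).re ≤ S * σ.trace.re := by
  obtain ⟨s, hs, hss, hdet⟩ := posdef_sqrt hσ
  have hst : s * s⁻¹ = 1 := Matrix.mul_nonsing_inv s hdet
  have hts : s⁻¹ * s = 1 := Matrix.nonsing_inv_mul s hdet
  have ht : (s⁻¹).IsHermitian := hs.inv
  set K : Mat (κ × ι) := (1 : Mat κ) ⊗ₖ s⁻¹ with hK
  set J : Mat (κ × ι) := (1 : Mat κ) ⊗ₖ s with hJ
  have hKh : Kᴴ = K := by rw [hK, Matrix.conjTranspose_kronecker, ht.eq, Matrix.conjTranspose_one]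
  have hJh : Jᴴ = J := by rw [hJ, Matrix.conjTranspose_kronecker, hs.eq, Matrix.conjTranspose_one]
  have hJK : J * K = 1 := by
    rw [hJ, hK, ← Matrix.mul_kronecker_mul, hst, Matrix.one_mul, Matrix.one_kronecker_one]
  have hKJ : K * J = 1 := by
    rw [hJ, hK, ← Matrix.mul_kronecker_mul, hts, Matrix.one_mul, Matrix.one_kronecker_one]
  have hJJ : (1 : Mat κ) ⊗ₖ σ = J * J := by
    rw [hJ, ← Matrix.mul_kronecker_mul, hss, Matrix.one_mul]
  have hKσK : K * ((1 : Mat κ) ⊗ₖ σ) * K = 1 := by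
    rw [hJJ, ← Matrix.mul_assoc, hKJ, Matrix.one_mul, hJK]
  have hKYh : (K * Y * K).IsHermitian := by
    rw [Matrix.IsHermitian, Matrix.conjTranspose_mul, Matrix.conjTranspose_mul, hKh, hY.eq,
      Matrix.mul_assoc]
  have conjq : ∀ Z : Mat (κ × ι), (∀ q ∈ QC Pf ι κ, 0 ≤ ((q * Z).trace).re) →
      ∀ q ∈ QC Pf ι κ, 0 ≤ ((q * (K * Z * K)).trace).re := by
    intro Z hZ q hq
    have h := hZ _ (conj_mem Pf hq s⁻¹)
    rw [← hK, hKh] at h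
    have e : (q * (K * Z * K)).trace = (K * q * K * Z).trace := by
      rw [← Matrix.mul_assoc, Matrix.trace_mul_comm]
      simp only [Matrix.mul_assoc]
    rwa [e]
  have t1 : (1 - (-(K * Y * K))) ∈ tildeCone Pf ι κ := by
    rw [tilde_iff]
    refine ⟨Matrix.isHermitian_one.sub hKYh.neg, ?_⟩
    have := conjq _ h2
    rwa [Matrix.mul_add, Matrix.add_mul, hKσK, ← sub_neg_eq_add] at this
  have t2 : (1 + (-(K * Y * K))) ∈ tildeCone Pf ι κ := by
    rw [tilde_iff]
    refine ⟨Matrix.isHermitian_one.add hKYh.neg, ?_⟩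
    have := conjq _ h1
    rwa [Matrix.mul_sub, Matrix.sub_mul, hKσK, sub_eq_add_neg] at this
  let u : ι × ι → ℂ := fun p => s p.2 p.1
  have hτ := hσ.trace_pos
  rw [Complex.lt_def] at hτ
  set τ : ℝ := σ.trace.re with hτd
  have hτ0 : 0 < τ := hτ.1
  have hτc : σ.trace = (τ : ℂ) := Complex.ext rfl hτ.2.symm
  have hρ0 : (Matrix.vecMulVec u (star u)).PosSemidef := Matrix.posSemidef_vecMulVec_self_star u
  have hρ : (τ⁻¹ • Matrix.vecMulVec u (star u)).PosSemidef := hρ0.smul (by positivity)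
  have htr0 : (Matrix.vecMulVec u (star u)).trace = (τ : ℂ) := by
    rw [← hτc, ← hss]
    conv_rhs => rw [← hs.eq]
    nth_rewrite 1 [hs.eq]
    simp only [Matrix.trace, Matrix.diag, Matrix.vecMulVec_apply, Fintype.sum_prod_type,
      Matrix.mul_apply, Matrix.conjTranspose_apply, Pi.star_apply, u]
    rw [Finset.sum_comm]
  have htr : (τ⁻¹ • Matrix.vecMulVec u (star u)).trace = 1 := by
    rw [Matrix.trace_smul, htr0, Complex.real_smul, ← Complex.ofReal_mul,
      inv_mul_cancel₀ hτ0.ne', Complex.ofReal_one]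
  have hten : tensorId φ ι (τ⁻¹ • Matrix.vecMulVec u (star u)) = τ⁻¹ • (J * Choi φ * J) := by
    conv_rhs => rw [← hJh]
    nth_rewrite 1 [hJh]
    ext ⟨k, j⟩ ⟨k', j'⟩
    simp only [tensorId, Matrix.of_apply]
    rw [lin_expand hφ.1]
    simp only [hJ, Matrix.sum_apply, Matrix.smul_apply, Matrix.of_apply, Matrix.mul_apply,
      Matrix.vecMulVec_apply, Pi.star_apply, u, Fintype.sum_prod_type, Matrix.kroneckerMap_apply,
      Matrix.one_apply, Matrix.conjTranspose_apply, ite_mul, one_mul, zero_mul, apply_ite star,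
      star_zero, mul_ite, mul_zero, Complex.real_smul, smul_eq_mul, Choi]
    simp only [Finset.sum_ite_irrel, Finset.sum_const_zero, Finset.sum_ite_eq, Finset.mem_univ,
      if_true, Finset.sum_mul, Finset.mul_sum]
    rw [Finset.sum_comm]
    refine Finset.sum_congr rfl fun i _ => Finset.sum_congr rfl fun i' _ => ?_
    ring
  have hb := hS _ hρ htr _ t1 t2
  rw [hten] at hb
  have e : (τ⁻¹ • (J * Choi φ * J) * (-(K * Y * K))).trace
      = ((-(τ⁻¹) : ℝ) : ℂ) * (Choi φ * Y).trace := by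
    have e1 : J * Choi φ * J * (K * Y * K) = J * (Choi φ * Y * K) := by
      calc J * Choi φ * J * (K * Y * K) = J * Choi φ * (J * K) * Y * K := by
            simp only [Matrix.mul_assoc]
        _ = _ := by rw [hJK, Matrix.mul_one]; simp only [Matrix.mul_assoc]
    rw [Matrix.mul_neg, Matrix.trace_neg, Matrix.smul_mul, Matrix.trace_smul, e1,
      Matrix.trace_mul_comm, Matrix.mul_assoc, hKJ, Matrix.mul_one, Complex.real_smul]
    push_cast; ring
  rw [e, Complex.re_ofReal_mul] at hb
  have := mul_le_mul_of_nonneg_right hb hτ0.le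
  have e2 : -τ⁻¹ * ((Choi φ * Y).trace).re * τ = -((Choi φ * Y).trace).re := by
    field_simp
  linarith

lemma sigma_psd [Nonempty κ] {σ : Mat ι} (hσ : σ.IsHermitian)
    (h : ∀ q ∈ QC Pf ι κ, 0 ≤ ((q * ((1 : Mat κ) ⊗ₖ σ)).trace).re) : σ.PosSemidef := by
  refine Matrix.PosSemidef.of_dotProduct_mulVec_nonneg hσ fun x => ?_
  have h1 := h _ (kron_mem Pf (A := (1 : Mat κ)) Matrix.PosSemidef.one
    (Matrix.posSemidef_vecMulVec_self_star x))
  rw [← Matrix.mul_kronecker_mul, Matrix.one_mul, Matrix.trace_kronecker, Matrix.trace_one,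
    Matrix.vecMulVec_mul, Matrix.trace_vecMulVec, dotProduct_comm, ← Matrix.dotProduct_mulVec] at h1
  have hk : (0:ℝ) < Fintype.card κ := by exact_mod_cast Fintype.card_pos
  rw [← Complex.ofReal_natCast, Complex.re_ofReal_mul] at h1
  rw [Complex.le_def]
  refine ⟨(mul_nonneg_iff_of_pos_left hk).1 h1, ?_⟩
  have := hσ.im_star_dotProduct_mulVec_self x
  exact this.symm

end Aux3

section Aux4
variable {ι κ : Type} [Fintype ι] [DecidableEq ι] [Fintype κ] [DecidableEq κ]
variable (Pf : AdmissibleFamily)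

attribute [local instance] Matrix.normedAddCommGroup Matrix.normedSpace

/-- The linear map `(q₁, q₂) ↦ (Tr_K (q₁ + q₂), q₂ - q₁)`. -/
def gmap (ι κ : Type) [Fintype ι] [Fintype κ] :
    (Mat (κ × ι) × Mat (κ × ι)) →ₗ[ℝ] (Mat ι × Mat (κ × ι)) where
  toFun x := (ptr (x.1 + x.2), x.2 - x.1)
  map_add' x y := by
    refine Prod.ext ?_ ?_
    · ext i j
      simp only [ptr, Matrix.of_apply, Matrix.add_apply, Prod.fst_add, Prod.snd_add,
        Finset.sum_add_distrib]
      ring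
    · simp only [Prod.fst_add, Prod.snd_add]; abel
  map_smul' c x := by
    refine Prod.ext ?_ ?_
    · ext i j
      simp only [ptr, Matrix.of_apply, Matrix.add_apply, Prod.smul_fst, Prod.smul_snd,
        Matrix.smul_apply, Finset.smul_sum, smul_add, RingHom.id_apply]
    · simp only [Prod.smul_fst, Prod.smul_snd, RingHom.id_apply, smul_sub]

/-- The real part of the trace of the first component. -/
def hmap (ι κ : Type) [Fintype ι] [Fintype κ] : (Mat ι × Mat (κ × ι)) →ₗ[ℝ] ℝ where
  toFun x := x.1.trace.re
  map_add' x y := by simp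
  map_smul' c x := by simp [Matrix.trace_smul]

lemma trace_ptr_one (M : Mat (κ × ι)) : (ptr M).trace = M.trace := by
  have := trace_ptr M (1 : Mat ι)
  simpa [Matrix.one_kronecker_one] using this

lemma ptr_herm {M : Mat (κ × ι)} (h : M.IsHermitian) : (ptr M).IsHermitian := by
  ext i j
  simp only [ptr, Matrix.conjTranspose_apply, Matrix.of_apply, star_sum]
  exact Finset.sum_congr rfl fun k _ => h.apply _ _

lemma strong [Nonempty ι] [Nonempty κ] {φ : HMap ι κ} (hφ : IsHermMap φ) {S l : ℝ}
    (hS : ∀ ρ : Mat (ι × ι), ρ.PosSemidef → ρ.trace = 1 → ∀ Y : Mat (κ × ι),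
      (1 - Y) ∈ tildeCone Pf ι κ → (1 + Y) ∈ tildeCone Pf ι κ →
      ((tensorId φ ι ρ * Y).trace).re ≤ S)
    (hSl : S < l) (hl : 0 < l) : l ∈ dset Pf φ := by
  by_contra hcon
  obtain ⟨f, hf, hfy⟩ := farkas_aux ((QC Pf ι κ) ×ˢ (QC Pf ι κ))
    ((QC_closed Pf).prod (QC_closed Pf)) ⟨QC_zero Pf, QC_zero Pf⟩
    (fun x hx y hy => ⟨QC_add Pf hx.1 hy.1, QC_add Pf hx.2 hy.2⟩)
    (fun c hc x hx => ⟨QC_smul Pf c hc hx.1, QC_smul Pf c hc hx.2⟩)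
    (gmap ι κ) (hmap ι κ)
    (by
      rintro ⟨q1, q2⟩ ⟨h1, h2⟩ hne
      have e : hmap ι κ (gmap ι κ (q1, q2)) = q1.trace.re + q2.trace.re := by
        show (ptr (q1 + q2)).trace.re = _
        rw [trace_ptr_one, Matrix.trace_add, Complex.add_re]
      rw [e]
      have n1 := (Complex.le_def.1 (QC_trace_nonneg Pf h1)).1
      have n2 := (Complex.le_def.1 (QC_trace_nonneg Pf h2)).1
      simp only [Complex.zero_re] at n1 n2
      by_cases h : q1 = 0
      · have h' : q2 ≠ 0 := fun h'' => hne (by rw [h, h'']; rfl)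
        have := QC_trace_pos Pf h2 h'
        linarith
      · have := QC_trace_pos Pf h1 h
        linarith)
    ((2 * l) • 1, (2 : ℝ) • Choi φ)
    (by
      rintro ⟨q1, q2⟩ ⟨h1, h2⟩ he
      exact hcon (mem_dset_of Pf hφ hl h1 h2 (congrArg Prod.fst he) (congrArg Prod.snd he)))
  obtain ⟨σ, hσ, hσr⟩ := repr_functional (f ∘ₗ LinearMap.inl ℝ (Mat ι) (Mat (κ × ι)))
  obtain ⟨Y, hY, hYr⟩ := repr_functional (f ∘ₗ LinearMap.inr ℝ (Mat ι) (Mat (κ × ι)))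
  have hsplit : ∀ (A : Mat ι) (B : Mat (κ × ι)), A.IsHermitian → B.IsHermitian →
      f (A, B) = ((A * σ).trace).re + ((B * Y).trace).re := by
    intro A B hA hB
    rw [← hσr A hA, ← hYr B hB]
    simp only [LinearMap.comp_apply, LinearMap.inl_apply, LinearMap.inr_apply]
    rw [← map_add]
    simp
  have p1 : ∀ q ∈ QC Pf ι κ, 0 ≤ ((q * ((1 : Mat κ) ⊗ₖ σ - Y)).trace).re := by
    intro q hq
    have h := hf (q, 0) ⟨hq, QC_zero Pf⟩
    have e : gmap ι κ (q, 0) = (ptr q, -q) := by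
      show (ptr (q + 0), 0 - q) = _
      rw [add_zero, zero_sub]
    rw [e, hsplit _ _ (ptr_herm (QC_herm Pf hq)) (QC_herm Pf hq).neg, trace_ptr,
      Matrix.neg_mul, Matrix.trace_neg, Complex.neg_re] at h
    rw [Matrix.mul_sub, Matrix.trace_sub, Complex.sub_re]
    linarith
  have p2 : ∀ q ∈ QC Pf ι κ, 0 ≤ ((q * ((1 : Mat κ) ⊗ₖ σ + Y)).trace).re := by
    intro q hq
    have h := hf (0, q) ⟨QC_zero Pf, hq⟩
    have e : gmap ι κ (0, q) = (ptr q, q) := by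
      show (ptr (0 + q), q - 0) = _
      rw [zero_add, sub_zero]
    rw [e, hsplit _ _ (ptr_herm (QC_herm Pf hq)) (QC_herm Pf hq), trace_ptr] at h
    rw [Matrix.mul_add, Matrix.trace_add, Complex.add_re]
    linarith
  have hpsd : σ.PosSemidef := by
    refine sigma_psd Pf (κ := κ) hσ fun q hq => ?_
    have a := p1 q hq
    have b := p2 q hq
    rw [Matrix.mul_sub, Matrix.trace_sub, Complex.sub_re] at a
    rw [Matrix.mul_add, Matrix.trace_add, Complex.add_re] at b
    linarith
  have hh1 : ((2 * l) • (1 : Mat ι)).IsHermitian := by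
    rw [Matrix.IsHermitian, Matrix.conjTranspose_smul, Matrix.conjTranspose_one]; simp
  have hh2 : ((2 : ℝ) • Choi φ).IsHermitian := by
    rw [Matrix.IsHermitian, Matrix.conjTranspose_smul, (Choi_herm hφ).eq]; simp
  rw [hsplit _ _ hh1 hh2, Matrix.smul_mul, Matrix.smul_mul, Matrix.one_mul, Matrix.trace_smul,
    Matrix.trace_smul, Complex.smul_re, Complex.smul_re, smul_eq_mul, smul_eq_mul] at hfy
  have hn : (0:ℝ) < Fintype.card ι := by exact_mod_cast Fintype.card_pos
  set n : ℝ := (Fintype.card ι : ℝ) with hnd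
  set N : ℝ := l * σ.trace.re + ((Choi φ * Y).trace).re with hN
  have hN0 : N < 0 := by rw [hN]; linarith
  obtain ⟨ε, hε, hεe⟩ : ∃ ε : ℝ, 0 < ε ∧ l * (ε * n) = -N / 2 :=
    ⟨-N / (2 * l * n), by apply div_pos <;> [linarith; positivity], by field_simp⟩
  have hpd : (σ + ε • (1 : Mat ι)).PosDef :=
    Matrix.PosDef.posSemidef_add hpsd (Matrix.PosDef.one.smul hε)
  have hkr : (1 : Mat κ) ⊗ₖ (σ + ε • (1 : Mat ι)) = (1 : Mat κ) ⊗ₖ σ + ε • 1 := by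
    rw [Matrix.kronecker_add, Matrix.kronecker_smul, Matrix.one_kronecker_one]
  have htr : ∀ q ∈ QC Pf ι κ, 0 ≤ ((q * (ε • (1 : Mat (κ × ι)))).trace).re := by
    intro q hq
    have n1 := (Complex.le_def.1 (QC_trace_nonneg Pf hq)).1
    rw [Matrix.mul_smul, Matrix.mul_one, Matrix.trace_smul, Complex.smul_re, smul_eq_mul]
    exact mul_nonneg hε.le n1
  have hc := core Pf hφ hS hpd hY
    (fun q hq => by
      have a := p1 q hq
      have b := htr q hq
      rw [hkr, add_sub_right_comm, Matrix.mul_add, Matrix.trace_add, Complex.add_re]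
      linarith)
    (fun q hq => by
      have a := p2 q hq
      have b := htr q hq
      rw [hkr, add_right_comm, Matrix.mul_add, Matrix.trace_add, Complex.add_re]
      linarith)
  have ht0 : 0 ≤ (σ + ε • (1 : Mat ι)).trace.re := (Complex.le_def.1 hpd.posSemidef.trace_nonneg).1
  have hle := mul_le_mul_of_nonneg_right hSl.le ht0
  have hte : (σ + ε • (1 : Mat ι)).trace.re = σ.trace.re + ε * n := by
    rw [Matrix.trace_add, Matrix.trace_smul, Matrix.trace_one]
    simp [hnd]
  rw [hte] at hc hle
  rw [mul_add] at hle
  have : - ((Choi φ * Y).trace).re ≤ l * σ.trace.re + l * (ε * n) := by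
    linarith
  rw [hεe] at this
  linarith

lemma state_exists [Nonempty ι] : ∃ ρ : Mat (ι × ι), ρ.PosSemidef ∧ ρ.trace = 1 := by
  have hn : (0:ℝ) < Fintype.card (ι × ι) := by exact_mod_cast Fintype.card_pos
  refine ⟨((Fintype.card (ι × ι) : ℝ))⁻¹ • 1, smul_one_psd (by positivity), ?_⟩
  rw [Matrix.trace_smul, Matrix.trace_one, ← Complex.ofReal_natCast, Complex.real_smul,
    ← Complex.ofReal_mul, inv_mul_cancel₀ hn.ne', Complex.ofReal_one]

lemma zero_mem_ball (X : Mat (κ × ι)) : (0:ℝ) ∈ {r : ℝ | ∃ Y : Mat (κ × ι),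
    (1 - Y) ∈ tildeCone Pf ι κ ∧ (1 + Y) ∈ tildeCone Pf ι κ ∧ r = ((X * Y).trace).re} :=
  ⟨0, by rw [sub_zero]; exact one_mem_tilde Pf, by rw [add_zero]; exact one_mem_tilde Pf, by simp⟩

end Aux4

/-- `‖φ‖_{◇,𝒫} = sup_{ρ ∈ 𝔖(H⊗H)} ‖(φ ⊗ id_H)(ρ)‖_{1,~𝒫}`. -/
theorem statement2 (Pf : AdmissibleFamily) {ι κ : Type} [Fintype ι] [DecidableEq ι]
    [Fintype κ] [DecidableEq κ] (φ : HMap ι κ) (hφ : IsHermMap φ) :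
    dnormP Pf (FdSubalgebra.full ι) (FdSubalgebra.full κ) φ =
      sSup {r : ℝ | ∃ ρ : Mat (ι × ι), ρ.PosSemidef ∧ ρ.trace = 1 ∧
        r = oneNormTilde Pf (tensorId φ ι ρ)} := by
  show sInf (dset Pf φ) = _
  rcases isEmpty_or_nonempty ι with hι | hι
  · have h1 : dset Pf φ = Set.Ioi 0 := by
      ext l
      refine ⟨fun h => h.1, fun h => ?_⟩
      exact mem_dset_of Pf hφ h (QC_zero Pf) (QC_zero Pf) (Subsingleton.elim _ _)
        (Subsingleton.elim _ _)
    have h2 : {r : ℝ | ∃ ρ : Mat (ι × ι), ρ.PosSemidef ∧ ρ.trace = 1 ∧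
        r = oneNormTilde Pf (tensorId φ ι ρ)} = ∅ := by
      ext r
      simp only [Set.mem_setOf_eq, Set.mem_empty_iff_false, iff_false]
      rintro ⟨ρ, -, h, -⟩
      simp [Matrix.trace] at h
    rw [h1, h2, csInf_Ioi, Real.sSup_empty]
  rcases isEmpty_or_nonempty κ with hκ | hκ
  · have h1 : dset Pf φ = ∅ := by
      ext l
      simp only [Set.mem_empty_iff_false, iff_false]
      rintro ⟨-, α, hα, -⟩
      have h := hα.2 1
      rw [Matrix.trace_one] at h
      simp [Matrix.trace] at h
      have h' : Fintype.card ι = 0 := by exact_mod_cast h.symm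
      exact Fintype.card_ne_zero h'
    have h0 : ∀ ρ : Mat (ι × ι), oneNormTilde Pf (tensorId φ ι ρ) = 0 := by
      intro ρ
      have : {r : ℝ | ∃ Y : Mat (κ × ι), (1 - Y) ∈ tildeCone Pf ι κ ∧
          (1 + Y) ∈ tildeCone Pf ι κ ∧ r = ((tensorId φ ι ρ * Y).trace).re} = {0} := by
        ext r
        refine ⟨?_, ?_⟩
        · rintro ⟨Y, -, -, rfl⟩
          simp [Matrix.trace]
        · rintro rfl
          exact zero_mem_ball Pf _
      show sSup _ = _
      rw [this, csSup_singleton]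
    have h2 : {r : ℝ | ∃ ρ : Mat (ι × ι), ρ.PosSemidef ∧ ρ.trace = 1 ∧
        r = oneNormTilde Pf (tensorId φ ι ρ)} = {0} := by
      ext r
      refine ⟨?_, ?_⟩
      · rintro ⟨ρ, -, -, rfl⟩
        exact h0 ρ
      · rintro rfl
        obtain ⟨ρ, h, h'⟩ := state_exists (ι := ι)
        exact ⟨ρ, h, h', (h0 ρ).symm⟩
    rw [h1, h2, Real.sInf_empty, csSup_singleton]
  have hin : ∀ l ∈ dset Pf φ, ∀ ρ : Mat (ι × ι), ρ.PosSemidef → ρ.trace = 1 →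
      oneNormTilde Pf (tensorId φ ι ρ) ≤ l := by
    intro l hl ρ hρ htr
    refine csSup_le ⟨0, zero_mem_ball Pf _⟩ ?_
    rintro r ⟨Y, h1, h2, rfl⟩
    exact weak_dual Pf hl hρ htr h1 h2
  obtain ⟨l0, hl0⟩ := dset_nonempty Pf hφ
  have hbi : ∀ ρ : Mat (ι × ι), ρ.PosSemidef → ρ.trace = 1 → ∀ Y : Mat (κ × ι),
      (1 - Y) ∈ tildeCone Pf ι κ → (1 + Y) ∈ tildeCone Pf ι κ →
      ((tensorId φ ι ρ * Y).trace).re ≤ oneNormTilde Pf (tensorId φ ι ρ) := by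
    intro ρ hρ htr Y h1 h2
    refine le_csSup ⟨l0, ?_⟩ ⟨Y, h1, h2, rfl⟩
    rintro r ⟨Y', h1', h2', rfl⟩
    exact weak_dual Pf hl0 hρ htr h1' h2'
  obtain ⟨ρ0, hρ0, htr0⟩ := state_exists (ι := ι)
  set R : Set ℝ := {r : ℝ | ∃ ρ : Mat (ι × ι), ρ.PosSemidef ∧ ρ.trace = 1 ∧
        r = oneNormTilde Pf (tensorId φ ι ρ)} with hR
  have hRb : ∀ l ∈ dset Pf φ, ∀ r ∈ R, r ≤ l := by
    rintro l hl r ⟨ρ, hρ, htr, rfl⟩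
    exact hin l hl ρ hρ htr
  have hbd : BddAbove R := ⟨l0, fun r hr => hRb l0 hl0 r hr⟩
  have hS : ∀ ρ : Mat (ι × ι), ρ.PosSemidef → ρ.trace = 1 → ∀ Y : Mat (κ × ι),
      (1 - Y) ∈ tildeCone Pf ι κ → (1 + Y) ∈ tildeCone Pf ι κ →
      ((tensorId φ ι ρ * Y).trace).re ≤ sSup R := by
    intro ρ hρ htr Y h1 h2
    exact (hbi ρ hρ htr Y h1 h2).trans (le_csSup hbd ⟨ρ, hρ, htr, rfl⟩)
  have hS0 : 0 ≤ sSup R := by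
    have := hS ρ0 hρ0 htr0 0 (by rw [sub_zero]; exact one_mem_tilde Pf)
      (by rw [add_zero]; exact one_mem_tilde Pf)
    simpa using this
  apply le_antisymm
  · refine le_of_forall_gt_imp_ge_of_dense fun l hl => ?_
    exact csInf_le ⟨0, fun x hx => hx.1.le⟩ (strong Pf hφ hS hl (lt_of_le_of_lt hS0 hl))
  · exact le_csInf ⟨l0, hl0⟩ fun l hl => csSup_le ⟨_, ρ0, hρ0, htr0, rfl⟩ (hRb l hl)
end
end

section
/- Let (V,Q) be a finite-dimensional real ordered vector space with a proper cone Q and let B be a base section in (V,Q). Then the dual ~B := {b* ∈ Q* : ⟨b, b*⟩ = 1 for all b ∈ B} is a base section in (V*,Q*), and under the canonical identification V** = V one has ~~B = B. -/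
noncomputable section
open NormedSpace

variable {V : Type*} [NormedAddCommGroup V] [NormedSpace ℝ V] [FiniteDimensional ℝ V]

/-- The dual cone `Q* = {f ∈ V* : ⟨q,f⟩ ≥ 0 for all q ∈ Q}`. -/
def DualCone (Q : Set V) : Set (StrongDual ℝ V) := {f | ∀ q ∈ Q, 0 ≤ f q}

/-- A proper cone: closed, convex, closed under nonnegative scalar multiplication, pointed,
with nonempty interior. -/
def IsProperCone (Q : Set V) : Prop :=
  IsClosed Q ∧ Convex ℝ Q ∧ (∀ c : ℝ, 0 ≤ c → ∀ x ∈ Q, c • x ∈ Q) ∧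
    (∀ x, x ∈ Q → -x ∈ Q → x = 0) ∧ (interior Q).Nonempty

/-- A base of `Q`: a set of the form `S = {q ∈ Q : ⟨q,e⟩ = 1}` for some `e` in the interior
of the dual cone. -/
def IsBase (Q S : Set V) : Prop :=
  ∃ e ∈ interior (DualCone Q), S = {q | q ∈ Q ∧ e q = 1}

/-- A base section in `(V,Q)`: `B = T ∩ S` for a linear subspace `T` and a base `S` of `Q`,
such that `B` contains an interior point of `Q`. -/
def IsBaseSection (Q B : Set V) : Prop :=
  ∃ (T : Submodule ℝ V) (S : Set V), IsBase Q S ∧ B = ↑T ∩ S ∧ (B ∩ interior Q).Nonempty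

/-- The dual of a base section: `~B = {f ∈ Q* : ⟨b,f⟩ = 1 for all b ∈ B}`. -/
def DualSection (Q B : Set V) : Set (StrongDual ℝ V) :=
  {f | f ∈ DualCone Q ∧ ∀ b ∈ B, f b = 1}

theorem bipolar_aux (Q : Set V) (hQ : IsProperCone Q) (x : V)
    (hx : ∀ f ∈ DualCone Q, 0 ≤ f x) : x ∈ Q := by
  obtain ⟨hcl, hcv, hsm, -, hne⟩ := hQ
  by_contra hxQ
  obtain ⟨f, u, h1, h2⟩ := geometric_hahn_banach_closed_point hcv hcl hxQ
  obtain ⟨q0, hq0⟩ := hne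
  have h0 : (0 : V) ∈ Q := by
    have := hsm 0 le_rfl q0 (interior_subset hq0)
    simpa using this
  have hu : 0 < u := by simpa using h1 0 h0
  have hf : -f ∈ DualCone Q := by
    intro q hq
    by_contra hneg
    have hpos : 0 < f q := by
      simp at hneg
      exact hneg
    have := h1 _ (hsm (u / f q) (by positivity) q hq)
    simp [hpos.ne'] at this
  have := hx _ hf
  simp at this
  linarith

theorem incl_surj_aux : Function.Surjective (inclusionInDoubleDual ℝ V) := by
  intro F
  have hr : LinearMap.range (inclusionInDoubleDual ℝ V).toLinearMap = ⊤ := by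
    apply LinearMap.range_eq_top.2
    have hd : Module.finrank ℝ (StrongDual ℝ (StrongDual ℝ V)) = Module.finrank ℝ V := by
      have h : ∀ (W : Type _) [NormedAddCommGroup W] [NormedSpace ℝ W] [FiniteDimensional ℝ W],
          Module.finrank ℝ (StrongDual ℝ W) = Module.finrank ℝ W := by
        intro W _ _ _
        rw [← (LinearMap.toContinuousLinearMap (𝕜 := ℝ) (E := W) (F' := ℝ)).finrank_eq]
        exact Subspace.dual_finrank_eq
      rw [h, h]
    refine (LinearMap.injective_iff_surjective_of_finrank_eq_finrank hd.symm).1 ?_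
    exact (inclusionInDoubleDualLi ℝ (E := V)).injective
  have : F ∈ LinearMap.range (inclusionInDoubleDual ℝ V).toLinearMap := by rw [hr]; trivial
  exact this

theorem incl_interior_aux (Q : Set V) (b0 : V) (hb0i : b0 ∈ interior Q) :
    inclusionInDoubleDual ℝ V b0 ∈ interior (DualCone (DualCone Q)) := by
  have hop : IsOpenMap (inclusionInDoubleDual ℝ V).toLinearMap :=
    LinearMap.isOpenMap_of_finiteDimensional _ incl_surj_aux
  refine interior_maximal ?_ (hop _ isOpen_interior) ⟨b0, hb0i, rfl⟩
  rintro _ ⟨q, hq, rfl⟩ f hf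
  exact hf q (interior_subset hq)

/-- The dual of a base section `B` in `(V,Q)` is a base section in `(V*,Q*)`, and under the
canonical identification `V** = V` one has `~~B = B`. -/
theorem statement17 (Q B : Set V) (hQ : IsProperCone Q) (hB : IsBaseSection Q B) :
    IsBaseSection (DualCone Q) (DualSection Q B) ∧
      (inclusionInDoubleDual ℝ V) '' B
        = DualSection (DualCone Q) (DualSection Q B) := by
  obtain ⟨T, S, ⟨e, he, rfl⟩, rfl, b0, hb0, hb0i⟩ := hB
  have heQ := interior_subset he
  have heB : e ∈ DualSection Q (↑T ∩ {q | q ∈ Q ∧ e q = 1}) := ⟨heQ, fun b hb => hb.2.2⟩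
  constructor
  · refine ⟨{ carrier := {f | ∀ b ∈ (↑T ∩ {q | q ∈ Q ∧ e q = 1} : Set V), f b = f b0}
              add_mem' := ?_, zero_mem' := ?_, smul_mem' := ?_ }, _,
      ⟨inclusionInDoubleDual ℝ V b0, ?_, rfl⟩, ?_, e, heB, he⟩
    · intro f g hf hg b hb
      simp [hf b hb, hg b hb]
    · intro b hb
      simp
    · intro c f hf b hb
      simp [hf b hb]
    · exact incl_interior_aux Q b0 hb0i
    · ext f
      constructor
      · rintro ⟨hf, h1⟩
        exact ⟨fun b hb => (h1 b hb).trans (h1 b0 hb0).symm, hf, h1 b0 hb0⟩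
      · rintro ⟨h1, hf, h2⟩
        exact ⟨hf, fun b hb => (h1 b hb).trans h2⟩
  · ext F
    constructor
    · rintro ⟨b, hb, rfl⟩
      exact ⟨fun f hf => hf b hb.2.1, fun f hf => hf.2 b hb⟩
    · rintro ⟨hF, h1⟩
      obtain ⟨x, rfl⟩ := incl_surj_aux F
      have hxe : e x = 1 := h1 e heB
      refine ⟨x, ⟨?_, bipolar_aux Q hQ x hF, hxe⟩, rfl⟩
      by_contra hxT
      obtain ⟨g0, hg0, hgT⟩ := Submodule.exists_le_ker_of_notMem hxT
      let g : StrongDual ℝ V := LinearMap.toContinuousLinearMap g0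
      have hc : Filter.Tendsto (fun t : ℝ => e + t • g) (nhdsWithin 0 {0}ᶜ) (nhds e) := by
        have : Continuous (fun t : ℝ => e + t • g) := by fun_prop
        have h := this.tendsto 0
        simp only [zero_smul, add_zero] at h
        exact h.mono_left nhdsWithin_le_nhds
      have hev := hc.eventually (mem_interior_iff_mem_nhds.1 he)
      obtain ⟨t, ht, ht0⟩ := (hev.and self_mem_nhdsWithin).exists
      have hm : e + t • g ∈ DualSection Q (↑T ∩ {q | q ∈ Q ∧ e q = 1}) := by
        refine ⟨ht, fun b hb => ?_⟩
        have hgb : g b = 0 := hgT hb.1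
        simp [hgb, hb.2.2]
      have h2 : (e + t • g) x = 1 := h1 _ hm
      have hgx : g x ≠ 0 := hg0
      simp [hxe, hgx] at h2
      exact ht0 h2
end
end

section
/- Let (V,Q) be a finite-dimensional real ordered vector space with a proper cone Q and let B be a base section in (V,Q). Then the set O_B := {q₁ − q₂ : q₁, q₂ ∈ Q, q₁ + q₂ ∈ B} = {x ∈ V : ∃ b ∈ B, b − x ∈ Q and b + x ∈ Q} is the closed unit ball of a norm ‖·‖_B on V, and the dual norm on V* is ‖·‖_{~B}, the norm whose unit ball is O_{~B} with respect to the dual base section ~B in (V*,Q*). -/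
noncomputable section
open NormedSpace

variable {V : Type*} [NormedAddCommGroup V] [NormedSpace ℝ V] [FiniteDimensional ℝ V]

/-- `O_B = {x : ∃ b ∈ B, b - x ∈ Q and b + x ∈ Q}`. -/
def OB (Q B : Set V) : Set V := {x | ∃ b ∈ B, b - x ∈ Q ∧ b + x ∈ Q}

theorem cone_add {Q : Set V} (hc : Convex ℝ Q) (hs : ∀ c : ℝ, 0 ≤ c → ∀ x ∈ Q, c • x ∈ Q)
    {x y : V} (hx : x ∈ Q) (hy : y ∈ Q) : x + y ∈ Q := by
  have h := hc hx hy (a := 1 / 2) (b := 1 / 2) (by norm_num) (by norm_num) (by norm_num)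
  have h2 := hs 2 (by norm_num) _ h
  have e : (2 : ℝ) • ((1 / 2 : ℝ) • x + (1 / 2 : ℝ) • y) = x + y := by module
  rwa [e] at h2

theorem base_bound {Q : Set V} {e : StrongDual ℝ V} (he : e ∈ interior (DualCone Q)) :
    ∃ C : ℝ, 0 < C ∧ ∀ q ∈ Q, ‖q‖ ≤ C * e q := by
  rw [mem_interior_iff_mem_nhds, Metric.mem_nhds_iff] at he
  obtain ⟨ε, hε, hb⟩ := he
  refine ⟨2 / ε, by positivity, fun q hq => ?_⟩
  obtain ⟨g, hg, hgq⟩ := exists_dual_vector'' ℝ q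
  have hm : e - (ε / 2) • g ∈ DualCone Q := by
    apply hb
    rw [Metric.mem_ball, dist_eq_norm]
    have : ‖e - (ε / 2) • g - e‖ = (ε / 2) * ‖g‖ := by
      rw [sub_sub_cancel_left, norm_neg, norm_smul, Real.norm_of_nonneg (by positivity)]
    rw [this]
    nlinarith
  have h := hm q hq
  have h2 : 0 ≤ e q - (ε / 2) * ‖q‖ := by
    simpa [hgq] using h
  rw [div_mul_eq_mul_div, le_div_iff₀ hε]
  linarith

theorem interior_absorb {Q : Set V} (hs : ∀ c : ℝ, 0 ≤ c → ∀ x ∈ Q, c • x ∈ Q)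
    {b : V} (hb : b ∈ interior Q) (y : V) :
    ∃ N : ℝ, ∀ M : ℝ, N ≤ M → M • b + y ∈ Q := by
  rw [mem_interior_iff_mem_nhds, Metric.mem_nhds_iff] at hb
  obtain ⟨ε, hε, hb⟩ := hb
  refine ⟨(‖y‖ + 1) / ε, fun M hM => ?_⟩
  have hM0 : 0 < M := lt_of_lt_of_le (by positivity) hM
  have h1 : b + M⁻¹ • y ∈ Q := by
    apply hb
    rw [Metric.mem_ball, dist_eq_norm, add_sub_cancel_left, norm_smul,
      Real.norm_of_nonneg (by positivity), inv_mul_lt_iff₀ hM0]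
    rw [div_le_iff₀ hε] at hM
    linarith
  have h2 := hs M hM0.le _ h1
  rwa [smul_add, smul_inv_smul₀ hM0.ne'] at h2

theorem dual_extend {Q : Set V} (hc : Convex ℝ Q) (hs : ∀ c : ℝ, 0 ≤ c → ∀ x ∈ Q, c • x ∈ Q)
    {e f : StrongDual ℝ V} (he : e ∈ interior (DualCone Q)) (T : Submodule ℝ V) {b₀ : V}
    (hb : b₀ ∈ interior Q) (hbT : b₀ ∈ T)
    (hf : ∀ x ∈ OB Q (↑T ∩ {q | q ∈ Q ∧ e q = 1}), f x ≤ 1) :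
    f ∈ OB (DualCone Q) (DualSection Q (↑T ∩ {q | q ∈ Q ∧ e q = 1})) := by
  obtain ⟨C, hC, hCb⟩ := base_bound he
  have he' : ∀ q ∈ Q, 0 ≤ e q := interior_subset he
  have h0 : (0 : V) ∈ Q := by simpa using hs 0 le_rfl b₀ (interior_subset hb)
  let s : PointedCone ℝ (V × V) :=
    { carrier := {p | p.1 ∈ Q ∧ p.2 ∈ Q}
      add_mem' := fun {a b} ha hb => ⟨cone_add hc hs ha.1 hb.1, cone_add hc hs ha.2 hb.2⟩
      zero_mem' := ⟨h0, h0⟩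
      smul_mem' := fun c p hp => ⟨hs c c.2 _ hp.1, hs c c.2 _ hp.2⟩ }
  let D : Submodule ℝ (V × V) :=
    T.comap (LinearMap.fst ℝ V V + LinearMap.snd ℝ V V)
  let L : V × V →ₗ[ℝ] ℝ :=
    f.toLinearMap.comp (LinearMap.fst ℝ V V - LinearMap.snd ℝ V V) +
      e.toLinearMap.comp (LinearMap.fst ℝ V V + LinearMap.snd ℝ V V)
  have hL : ∀ x y, L (x, y) = f (x - y) + e (x + y) := fun x y => rfl
  have hD : ∀ x y, (x, y) ∈ D ↔ x + y ∈ T := fun x y => Iff.rfl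
  obtain ⟨H, hH, hHn⟩ := riesz_extension s ⟨D, L.comp D.subtype⟩ (by
    rintro ⟨⟨x, y⟩, hxy⟩ ⟨hx, hy⟩
    change 0 ≤ L (x, y)
    change x ∈ Q at hx
    change y ∈ Q at hy
    have hxy' : x + y ∈ T := hxy
    rw [hL]
    have hx0 := he' x hx
    have hy0 := he' y hy
    have hxb := hCb x hx
    have hyb := hCb y hy
    rcases (add_nonneg hx0 hy0).eq_or_lt with h | h
    · have h1 : e x = 0 := by linarith
      have h2 : e y = 0 := by linarith
      rw [h1, mul_zero] at hxb
      rw [h2, mul_zero] at hyb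
      rw [norm_le_zero_iff.1 hxb, norm_le_zero_iff.1 hyb]
      simp
    · set c := e x + e y with hcdef
      have hmem : c⁻¹ • (y - x) ∈ OB Q (↑T ∩ {q | q ∈ Q ∧ e q = 1}) := by
        refine ⟨c⁻¹ • (x + y), ⟨T.smul_mem _ hxy', hs _ (by positivity) _ (cone_add hc hs hx hy), ?_⟩,
          ?_, ?_⟩
        · rw [map_smul, map_add, ← hcdef, smul_eq_mul, inv_mul_cancel₀ h.ne']
        · have : c⁻¹ • (x + y) - c⁻¹ • (y - x) = (2 * c⁻¹) • x := by module
          rw [this]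
          exact hs _ (by positivity) _ hx
        · have : c⁻¹ • (x + y) + c⁻¹ • (y - x) = (2 * c⁻¹) • y := by module
          rw [this]
          exact hs _ (by positivity) _ hy
      have h3 := hf _ hmem
      rw [map_smul, smul_eq_mul, inv_mul_le_iff₀ h, map_sub] at h3
      rw [map_sub, map_add]
      linarith) (by
    rintro ⟨y₁, y₂⟩
    obtain ⟨N₁, h₁⟩ := interior_absorb hs hb y₁
    obtain ⟨N₂, h₂⟩ := interior_absorb hs hb y₂
    refine ⟨⟨(max N₁ N₂ • b₀, max N₁ N₂ • b₀), ?_⟩, ?_⟩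
    · exact T.add_mem (T.smul_mem _ hbT) (T.smul_mem _ hbT)
    · exact ⟨h₁ _ (le_max_left _ _), h₂ _ (le_max_right _ _)⟩)
  have hHD : ∀ x y, x + y ∈ T → H (x, y) = f (x - y) + e (x + y) :=
    fun x y h => hH ⟨(x, y), h⟩
  have hsplit : ∀ x y, H (x, y) = H (x, 0) + H (0, y) := fun x y => by
    rw [← map_add]; simp
  have hneg : ∀ x, H (x, 0) - H (0, x) = 2 * f x := fun x => by
    have h1 := hHD x (-x) (by simp)
    have h2 : H (0, -x) = - H (0, x) := by rw [← map_neg]; simp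
    rw [hsplit, h2] at h1
    simp only [sub_neg_eq_add, map_add, add_neg_cancel, map_zero] at h1
    linarith
  let g : StrongDual ℝ V := LinearMap.toContinuousLinearMap
    ((1 / 2 : ℝ) • (H.comp (LinearMap.inl ℝ V V) + H.comp (LinearMap.inr ℝ V V)))
  have hg : ∀ x, g x = (1 / 2) * (H (x, 0) + H (0, x)) := fun x => rfl
  have p1 : ∀ q ∈ Q, 0 ≤ H (q, 0) := fun q hq => hHn _ ⟨hq, h0⟩
  have p2 : ∀ q ∈ Q, 0 ≤ H (0, q) := fun q hq => hHn _ ⟨h0, hq⟩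
  refine ⟨g, ⟨fun q hq => ?_, fun b hb => ?_⟩, fun q hq => ?_, fun q hq => ?_⟩
  · rw [hg]; linarith [p1 q hq, p2 q hq]
  · rw [hg, ← hsplit, hHD b b (T.add_mem hb.1 hb.1)]
    have : e b = 1 := hb.2.2
    simp [this]
    norm_num
  · rw [ContinuousLinearMap.sub_apply, hg]; linarith [p2 q hq, hneg q]
  · rw [ContinuousLinearMap.add_apply, hg]; linarith [p1 q hq, hneg q]

theorem OB_isCompact {Q : Set V} (hcl : IsClosed Q)
    {e : StrongDual ℝ V} (he : e ∈ interior (DualCone Q)) (T : Submodule ℝ V) :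
    IsCompact (OB Q (↑T ∩ {q | q ∈ Q ∧ e q = 1})) := by
  obtain ⟨C, hC, hCb⟩ := base_bound he
  let K : Set (V × V) := {p | p.1 ∈ T ∧ (p.1 ∈ Q ∧ e p.1 = 1) ∧ p.1 - p.2 ∈ Q ∧ p.1 + p.2 ∈ Q}
  have hTc : IsClosed (T : Set V) := T.closed_of_finiteDimensional
  have hKc : IsClosed K := by
    refine (hTc.preimage continuous_fst).inter (((hcl.preimage continuous_fst).inter
      (isClosed_eq (e.continuous.comp continuous_fst) continuous_const)).inter
      ((hcl.preimage (continuous_fst.sub continuous_snd)).inter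
        (hcl.preimage (continuous_fst.add continuous_snd))))
  have hKb : Bornology.IsBounded K := by
    rw [isBounded_iff_forall_norm_le]
    refine ⟨C, ?_⟩
    rintro ⟨b, x⟩ ⟨-, ⟨hb, h1⟩, hm, hp⟩
    change b ∈ Q at hb
    change e b = 1 at h1
    change b - x ∈ Q at hm
    change b + x ∈ Q at hp
    have a1 := hCb _ hb
    have a2 := hCb _ hm
    have a3 := hCb _ hp
    rw [map_sub, h1] at a2
    rw [map_add, h1] at a3
    rw [h1] at a1
    have : ‖(2 : ℝ) • x‖ ≤ ‖b + x‖ + ‖b - x‖ := by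
      have h : (2 : ℝ) • x = (b + x) - (b - x) := by module
      rw [h]; exact norm_sub_le _ _
    rw [norm_smul, Real.norm_of_nonneg (by norm_num)] at this
    exact max_le (by simpa using a1) (by change ‖x‖ ≤ C; linarith)
  have hK : IsCompact K := Metric.isCompact_of_isClosed_isBounded hKc hKb
  have : OB Q (↑T ∩ {q | q ∈ Q ∧ e q = 1}) = Prod.snd '' K := by
    ext x
    constructor
    · rintro ⟨b, ⟨hT, hq⟩, hm, hp⟩
      exact ⟨(b, x), ⟨hT, hq, hm, hp⟩, rfl⟩
    · rintro ⟨⟨b, x⟩, ⟨hT, hq, hm, hp⟩, rfl⟩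
      exact ⟨b, ⟨hT, hq⟩, hm, hp⟩
  rw [this]
  exact hK.image continuous_snd

/-- `O_B` is the closed unit ball of a norm `‖·‖_B` on `V` whose dual norm on `V*` has
closed unit ball `O_{~B}`, taken with respect to the dual cone `Q*` and the dual base
section `~B`. -/
theorem statement18 (Q B : Set V) (hQ : IsProperCone Q) (hB : IsBaseSection Q B) :
    ({x : V | ∃ q₁ q₂, q₁ ∈ Q ∧ q₂ ∈ Q ∧ q₁ + q₂ ∈ B ∧ x = q₁ - q₂} = OB Q B) ∧
    ∃ nB : V → ℝ,
      (∀ x, 0 ≤ nB x) ∧ (∀ x, nB x = 0 ↔ x = 0) ∧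
      (∀ (c : ℝ) (x : V), nB (c • x) = |c| * nB x) ∧
      (∀ x y, nB (x + y) ≤ nB x + nB y) ∧
      ({x | nB x ≤ 1} = OB Q B) ∧
      ({f : StrongDual ℝ V | ∀ x, nB x ≤ 1 → f x ≤ 1}
        = OB (DualCone Q) (DualSection Q B)) := by
  obtain ⟨hcl, hc, hs, -, -⟩ := hQ
  obtain ⟨T, S, ⟨e, he, rfl⟩, rfl, b₀, hb₀, hb₀i⟩ := hB
  have hcomp := OB_isCompact hcl he T
  have hcv : Convex ℝ (OB Q (↑T ∩ {q | q ∈ Q ∧ e q = 1})) := by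
    rintro x ⟨b, ⟨hbT, hbQ, hbe⟩, hm, hp⟩ y ⟨b', ⟨hbT', hbQ', hbe'⟩, hm', hp'⟩ s t hs0 ht0 hst
    refine ⟨s • b + t • b', ⟨T.add_mem (T.smul_mem _ hbT) (T.smul_mem _ hbT'),
      hc hbQ hbQ' hs0 ht0 hst, ?_⟩, ?_, ?_⟩
    · simp [hbe, hbe', hst]
    · have : s • b + t • b' - (s • x + t • y) = s • (b - x) + t • (b' - y) := by module
      rw [this]; exact hc hm hm' hs0 ht0 hst
    · have : s • b + t • b' + (s • x + t • y) = s • (b + x) + t • (b' + y) := by module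
      rw [this]; exact hc hp hp' hs0 ht0 hst
  have hsym : ∀ x ∈ OB Q (↑T ∩ {q | q ∈ Q ∧ e q = 1}),
      -x ∈ OB Q (↑T ∩ {q | q ∈ Q ∧ e q = 1}) := by
    rintro x ⟨b, hb, hm, hp⟩
    exact ⟨b, hb, by simpa using hp, by simpa [sub_eq_add_neg] using hm⟩
  have hnh : OB Q (↑T ∩ {q | q ∈ Q ∧ e q = 1}) ∈ nhds (0 : V) := by
    have hQn : Q ∈ nhds b₀ := mem_interior_iff_mem_nhds.1 hb₀i
    have t1 : Filter.Tendsto (fun x : V => b₀ - x) (nhds 0) (nhds b₀) := by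
      have : Continuous (fun x : V => b₀ - x) := by fun_prop
      simpa using this.tendsto 0
    have t2 : Filter.Tendsto (fun x : V => b₀ + x) (nhds 0) (nhds b₀) := by
      have : Continuous (fun x : V => b₀ + x) := by fun_prop
      simpa using this.tendsto 0
    filter_upwards [t1 hQn, t2 hQn] with x h1 h2
    exact ⟨b₀, hb₀, h1, h2⟩
  have habs := absorbent_nhds_zero (𝕜 := ℝ) hnh
  have hle : ∀ x, gauge (OB Q (↑T ∩ {q | q ∈ Q ∧ e q = 1})) x ≤ 1 ↔
      x ∈ OB Q (↑T ∩ {q | q ∈ Q ∧ e q = 1}) := fun x => by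
    rw [gauge_le_one_iff_mem_closure hcv hnh, hcomp.isClosed.closure_eq]
  refine ⟨?_, gauge (OB Q (↑T ∩ {q | q ∈ Q ∧ e q = 1})), fun x => gauge_nonneg x, fun x =>
    gauge_eq_zero habs (NormedSpace.isVonNBounded_of_isBounded _ hcomp.isBounded), ?_,
    fun x y => gauge_add_le hcv habs x y, Set.ext hle, ?_⟩
  · ext x
    constructor
    · rintro ⟨q₁, q₂, h1, h2, hB, rfl⟩
      refine ⟨q₁ + q₂, hB, ?_, ?_⟩
      · have : q₁ + q₂ - (q₁ - q₂) = (2 : ℝ) • q₂ := by module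
        rw [this]; exact hs _ (by norm_num) _ h2
      · have : q₁ + q₂ + (q₁ - q₂) = (2 : ℝ) • q₁ := by module
        rw [this]; exact hs _ (by norm_num) _ h1
    · rintro ⟨b, hb, hm, hp⟩
      refine ⟨(1 / 2 : ℝ) • (b + x), (1 / 2 : ℝ) • (b - x), hs _ (by norm_num) _ hp,
        hs _ (by norm_num) _ hm, ?_, by module⟩
      have : (1 / 2 : ℝ) • (b + x) + (1 / 2 : ℝ) • (b - x) = b := by module
      rw [this]; exact hb
  · intro c x
    have h := gauge_smul_of_nonneg (s := OB Q (↑T ∩ {q | q ∈ Q ∧ e q = 1})) (abs_nonneg c) x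
    rw [smul_eq_mul] at h
    rw [← h]
    rcases abs_choice c with h' | h'
    · rw [h']
    · rw [h', neg_smul, gauge_neg hsym]
  · ext f
    constructor
    · intro hf
      exact dual_extend hc hs he T hb₀i hb₀.1 (fun x hx => hf x ((hle x).2 hx))
    · rintro ⟨g, ⟨-, hgB⟩, hm, hp⟩ x hx
      obtain ⟨b, hb, hbm, hbp⟩ := (hle x).1 hx
      have h1 := hm _ hbp
      have h2 := hp _ hbm
      have h3 := hgB b hb
      simp only [ContinuousLinearMap.sub_apply, ContinuousLinearMap.add_apply, map_add, map_sub]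
        at h1 h2
      linarith
end
end
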